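/- Let n ≥ 2, let Ω ⊂ ℝⁿ be open, and let A be a Young function; if n ≥ 3 assume that ∫^∞ (t/A(t))^{1/(n−2)} dt < ∞. Then every weakly monotone function u ∈ W^{1,A}_loc(Ω) admits a representative (namely the function x ↦ limsup_{r→0⁺} ⨍_{B_r(x)} u dz) that is differentiable almost everywhere in Ω. -/

import Mathlib

open MeasureTheory Metric Set Filter ENNReal
open scoped Topology NNReal

noncomputable section

/-- Euclidean space `ℝⁿ`. -/
abbrev Euc (n : ℕ) : Type := EuclideanSpace ℝ (Fin n)

/-- A Young function: a convex function `A : [0,∞) → [0,∞]` with `A 0 = 0`,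
not constant on `(0,∞)`.  (Only values on `[0,∞)` are relevant.) -/
def IsYoung (A : ℝ → ℝ≥0∞) : Prop :=
  A 0 = 0 ∧
    (∀ ⦃x y : ℝ⦄, 0 ≤ x → 0 ≤ y → ∀ ⦃l : ℝ⦄, 0 ≤ l → l ≤ 1 →
      A (l * x + (1 - l) * y) ≤ ENNReal.ofReal l * A x + ENNReal.ofReal (1 - l) * A y) ∧
    ∃ x y : ℝ, 0 < x ∧ 0 < y ∧ A x ≠ A y

/-- The Young conjugate `Ã(t) = sup { s·t − A(s) : s ≥ 0 }`. -/
def youngConj (A : ℝ → ℝ≥0∞) (t : ℝ) : ℝ≥0∞ :=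
  ⨆ s : Ici (0 : ℝ), (ENNReal.ofReal ((s : ℝ) * t) - A s)

/-- The exponent `(n-1)/(n-2)`. -/
def youngExp (n : ℕ) : ℝ := ((n : ℝ) - 1) / ((n : ℝ) - 2)

/-- The Young function `A_{n-1}`; equal to `A` for `n = 2`, and for `n ≥ 3` the
Young conjugate of `t ↦ t^{(n-1)/(n-2)} ∫_t^∞ Ã(r) r^{-1-(n-1)/(n-2)} dr`. -/
def youngShifted (n : ℕ) (A : ℝ → ℝ≥0∞) : ℝ → ℝ≥0∞ :=
  if n = 2 then A
  else youngConj fun t =>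
    ENNReal.ofReal (t ^ youngExp n) *
      ∫⁻ r in Ioi t, youngConj A r / ENNReal.ofReal (r ^ (1 + youngExp n))

/-- The generalized right-continuous inverse of a Young function. -/
def youngInv (A : ℝ → ℝ≥0∞) (τ : ℝ≥0∞) : ℝ≥0∞ :=
  ⨅ (s : ℝ) (_ : 0 ≤ s ∧ τ < A s), ENNReal.ofReal s

/-- The condition `∫^∞ (t/A(t))^{1/(n-2)} dt < ∞`. -/
def TailCondition (n : ℕ) (A : ℝ → ℝ≥0∞) : Prop :=
  ∃ t₀ : ℝ, 0 < t₀ ∧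
    ∫⁻ t in Ioi t₀, (ENNReal.ofReal t / A t) ^ (1 / ((n : ℝ) - 2)) < ∞

/-- The Δ₂-condition near infinity. -/
def Delta2Infty (A : ℝ → ℝ≥0∞) : Prop :=
  ∃ C : ℝ, 2 < C ∧ ∃ t₀ : ℝ, 0 ≤ t₀ ∧ ∀ t : ℝ, t₀ ≤ t → A (2 * t) ≤ ENNReal.ofReal C * A t

/-- `g` is the weak gradient of `u` on the open set `Ω`, with `u` and `g`
locally integrable on `Ω`. -/
def IsWeakGradOn {n : ℕ} (Ω : Set (Euc n)) (u : Euc n → ℝ) (g : Euc n → Euc n) : Prop :=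
  LocallyIntegrableOn u Ω volume ∧ LocallyIntegrableOn (fun x => ‖g x‖) Ω volume ∧
    ∀ φ : Euc n → ℝ, ContDiff ℝ (⊤ : ℕ∞) φ → HasCompactSupport φ → tsupport φ ⊆ Ω →
      ∀ i : Fin n,
        ∫ x, u x * fderiv ℝ φ x (EuclideanSpace.single i 1) = - ∫ x, g x i * φ x

/-- Membership in the Orlicz space `L^A(s)` (finiteness of the Luxemburg norm). -/
def MemOrliczOn {n : ℕ} (A : ℝ → ℝ≥0∞) (s : Set (Euc n)) (f : Euc n → ℝ) : Prop :=
  ∃ lam : ℝ, 0 < lam ∧ ∫⁻ x in s, A (|f x| / lam) < ∞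

/-- `u ∈ W^{1,A}_loc(Ω)`, with weak gradient `g`. -/
def MemW1Aloc {n : ℕ} (A : ℝ → ℝ≥0∞) (Ω : Set (Euc n)) (u : Euc n → ℝ)
    (g : Euc n → Euc n) : Prop :=
  IsWeakGradOn Ω u g ∧
    ∀ Ω' : Set (Euc n), IsOpen Ω' → IsCompact (closure Ω') → closure Ω' ⊆ Ω →
      MemOrliczOn A Ω' u ∧ MemOrliczOn A Ω' (fun x => ‖g x‖)

/-- `v ∈ W^{1,1}_0(Ω')`: `v` has a weak gradient on `Ω'` and is approximable in the
`W^{1,1}(Ω')` norm by smooth functions compactly supported in `Ω'`. -/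
def MemW110 {n : ℕ} (Ω' : Set (Euc n)) (v : Euc n → ℝ) : Prop :=
  ∃ h : Euc n → Euc n, IsWeakGradOn Ω' v h ∧
    ∃ φ : ℕ → Euc n → ℝ,
      (∀ k, ContDiff ℝ (⊤ : ℕ∞) (φ k) ∧ HasCompactSupport (φ k) ∧ tsupport (φ k) ⊆ Ω') ∧
      Tendsto (fun k => ∫ x in Ω', (|φ k x - v x| + ‖gradient (φ k) x - h x‖))
        atTop (𝓝 0)

/-- `u` is weakly monotone on `Ω`. -/
def WeaklyMonotone {n : ℕ} (Ω : Set (Euc n)) (u : Euc n → ℝ) : Prop :=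
  ∀ Ω' : Set (Euc n), IsOpen Ω' → IsCompact (closure Ω') → closure Ω' ⊆ Ω →
    ∀ m M : ℝ, m ≤ M →
      MemW110 Ω' (fun x => max (u x - M) 0 - max (m - u x) 0) →
      ∀ᵐ x ∂volume.restrict Ω', m ≤ u x ∧ u x ≤ M

/-- The essential oscillation of `u` on a set `s`. -/
def essOsc {n : ℕ} (s : Set (Euc n)) (u : Euc n → ℝ) : ℝ≥0∞ :=
  essSup (fun p : Euc n × Euc n => ENNReal.ofReal |u p.1 - u p.2|)
    ((volume.restrict s).prod (volume.restrict s))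

/-- The Riesz-type kernel `1 / (|x-y|ⁿ Ψ(1/|x-y|))`. -/
def rieszKernel {n : ℕ} (Ψ : ℝ → ℝ≥0∞) (x y : Euc n) : ℝ≥0∞ :=
  (ENNReal.ofReal (‖x - y‖ ^ n) * Ψ (1 / ‖x - y‖))⁻¹

/-- The Riesz-type potential `I_Ψ f`. -/
def rieszPot {n : ℕ} (Ψ : ℝ → ℝ≥0∞) (f : Euc n → ℝ≥0∞) (x : Euc n) : ℝ≥0∞ :=
  ∫⁻ y, f y * rieszKernel Ψ x y

/-- The capacity `C_{Ψ,1}`. -/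
def capPsi {n : ℕ} (Ψ : ℝ → ℝ≥0∞) (E : Set (Euc n)) : ℝ≥0∞ :=
  ⨅ (f : Euc n → ℝ≥0∞) (_ : Measurable f) (_ : ∀ x ∈ E, 1 ≤ rieszPot Ψ f x),
    ∫⁻ x, f x


/-- The canonical representative `x ↦ limsup_{r→0⁺} ⨍_{B_r(x)} u`. -/
def avgLimsupRep {n : ℕ} (u : Euc n → ℝ) (x : Euc n) : ℝ :=
  limsup (fun r : ℝ => ⨍ z in ball x r, u z) (𝓝[>] (0 : ℝ))

open scoped Convolution in
theorem lintegral_enorm_normed_convolution_le {E F : Type*} [NormedAddCommGroup E]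
    [NormedSpace ℝ E] [FiniteDimensional ℝ E] [MeasurableSpace E] [BorelSpace E]
    [NormedAddCommGroup F] [NormedSpace ℝ F] {μ : Measure E} [μ.IsAddHaarMeasure]
    (φ : ContDiffBump (0 : E)) {f : E → F} (hf : AEStronglyMeasurable f μ) :
    ∫⁻ x, ‖(φ.normed μ ⋆[ContinuousLinearMap.lsmul ℝ ℝ, μ] f) x‖ₑ ∂μ ≤ ∫⁻ x, ‖f x‖ₑ ∂μ := by
  have hρ : AEStronglyMeasurable (φ.normed μ) μ := φ.continuous_normed.aestronglyMeasurable
  have h1 : ∫⁻ t, ‖φ.normed μ t‖ₑ ∂μ = 1 := by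
    rw [← ofReal_integral_norm_eq_lintegral_enorm φ.integrable_normed]
    simp [abs_of_nonneg (φ.nonneg_normed _), φ.integral_normed]
  calc ∫⁻ x, ‖(φ.normed μ ⋆[ContinuousLinearMap.lsmul ℝ ℝ, μ] f) x‖ₑ ∂μ
      ≤ ∫⁻ x, ∫⁻ t, ‖φ.normed μ t • f (x - t)‖ₑ ∂μ ∂μ := by
        gcongr with x
        exact enorm_integral_le_lintegral_enorm _
    _ = ∫⁻ t, ∫⁻ x, ‖φ.normed μ t • f (x - t)‖ₑ ∂μ ∂μ := by
        refine lintegral_lintegral_swap ?_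
        exact (AEStronglyMeasurable.convolution_integrand
          (ContinuousLinearMap.lsmul ℝ ℝ) hρ hf).enorm
    _ = ∫⁻ t, ‖φ.normed μ t‖ₑ * ∫⁻ x, ‖f x‖ₑ ∂μ ∂μ := by
        congr 1; ext t
        simp_rw [enorm_smul]
        rw [lintegral_const_mul' _ _ (by simp)]
        congr 1
        exact lintegral_sub_right_eq_self (fun x => ‖f x‖ₑ) t
    _ = ∫⁻ x, ‖f x‖ₑ ∂μ := by
        rw [lintegral_mul_const'' _ hρ.enorm, h1, one_mul]

open scoped Convolution Pointwise in
theorem tendsto_lintegral_enorm_normed_convolution_sub_of_continuous {E F : Type*}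
    [NormedAddCommGroup E]
    [NormedSpace ℝ E] [FiniteDimensional ℝ E] [MeasurableSpace E] [BorelSpace E]
    [NormedAddCommGroup F] [NormedSpace ℝ F] [CompleteSpace F]
    {μ : Measure E} [μ.IsAddHaarMeasure]
    {φ : ℕ → ContDiffBump (0 : E)} (hφ : Tendsto (fun k => (φ k).rOut) atTop (𝓝 0))
    {f : E → F} (hf : Continuous f) (hfc : HasCompactSupport f) :
    Tendsto (fun k => ∫⁻ x, ‖((φ k).normed μ ⋆[ContinuousLinearMap.lsmul ℝ ℝ, μ] f) x - f x‖ₑ ∂μ)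
      atTop (𝓝 0) := by
  set S : Set E := closedBall 0 1 + tsupport f with hS
  have hSc : IsCompact S := (isCompact_closedBall 0 1).add hfc
  have huc : UniformContinuous f := hfc.uniformContinuous_of_continuous hf
  rw [ENNReal.tendsto_nhds_zero]
  intro ε hε
  obtain ⟨η, hη, hηS⟩ : ∃ η : ℝ≥0, 0 < η ∧ (η : ℝ≥0∞) * μ S < ε :=
    ENNReal.exists_nnreal_pos_mul_lt hSc.measure_lt_top.ne hε.ne'
  obtain ⟨δ, hδ, hδf⟩ := Metric.uniformContinuous_iff.1 huc η hη
  filter_upwards [hφ.eventually_lt_const (lt_min hδ one_pos)] with k hk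
  refine le_trans ?_ hηS.le
  rw [← setLIntegral_const, ← lintegral_indicator hSc.measurableSet]
  refine lintegral_mono fun x => ?_
  by_cases hx : x ∈ S
  · rw [indicator_of_mem hx, ← edist_eq_enorm_sub, edist_nndist, ENNReal.coe_le_coe,
      ← NNReal.coe_le_coe, coe_nndist]
    refine ContDiffBump.dist_normed_convolution_le hf.aestronglyMeasurable fun y hy => ?_
    exact (hδf (lt_trans hy (hk.trans_le (min_le_left _ _)))).le
  · rw [indicator_of_notMem hx, ← edist_eq_enorm_sub]
    have h0 : ∀ y ∈ ball x (φ k).rOut, f y = 0 := by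
      intro y hy
      by_contra h
      apply hx
      refine ⟨x - y, ?_, y, subset_tsupport _ h, by simp⟩
      have := hy.trans (hk.trans_le (min_le_right _ _))
      rw [dist_comm, dist_eq_norm] at this
      simpa using this.le
    have hd := ContDiffBump.dist_normed_convolution_le (φ := φ k) (μ := μ) (g := f) (x₀ := x)
      (ε := 0) hf.aestronglyMeasurable fun y hy => by
        rw [h0 y hy, h0 x (mem_ball_self (φ k).rOut_pos)]; simp
    rw [edist_dist]
    simpa using hd

open scoped Convolution in
theorem tendsto_lintegral_enorm_normed_convolution_sub {E F : Type*} [NormedAddCommGroup E]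
    [NormedSpace ℝ E] [FiniteDimensional ℝ E] [MeasurableSpace E] [BorelSpace E]
    [NormedAddCommGroup F] [NormedSpace ℝ F] [CompleteSpace F]
    {μ : Measure E} [μ.IsAddHaarMeasure]
    {φ : ℕ → ContDiffBump (0 : E)} (hφ : Tendsto (fun k => (φ k).rOut) atTop (𝓝 0))
    {f : E → F} (hf : Integrable f μ) :
    Tendsto (fun k => ∫⁻ x, ‖((φ k).normed μ ⋆[ContinuousLinearMap.lsmul ℝ ℝ, μ] f) x - f x‖ₑ ∂μ)
      atTop (𝓝 0) := by
  rw [ENNReal.tendsto_nhds_zero]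
  intro ε hε
  obtain ⟨η, hη, hηε⟩ : ∃ η : ℝ≥0, 0 < η ∧ (η : ℝ≥0∞) < ε := ENNReal.lt_iff_exists_nnreal_btwn.1 hε
    |>.imp fun _ h => ⟨by exact_mod_cast h.1, h.2⟩
  obtain ⟨h, hc, hle, hcont, hintg⟩ := hf.exists_hasCompactSupport_integral_sub_le
    (ε := η / 3) (by positivity)
  have hle' : ∫⁻ x, ‖f x - h x‖ₑ ∂μ ≤ ENNReal.ofReal (η / 3) := by
    have := ofReal_integral_norm_eq_lintegral_enorm (hf.sub hintg)
    simp only [Pi.sub_apply] at this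
    rw [← this]
    exact ENNReal.ofReal_le_ofReal hle
  have h2 := tendsto_lintegral_enorm_normed_convolution_sub_of_continuous (μ := μ) hφ hcont hc
  rw [ENNReal.tendsto_nhds_zero] at h2
  filter_upwards [h2 (ENNReal.ofReal (η / 3)) (by simpa using hη)] with k hk
  have e1 : ∀ x, ((φ k).normed μ ⋆[ContinuousLinearMap.lsmul ℝ ℝ, μ] f) x - f x =
      ((φ k).normed μ ⋆[ContinuousLinearMap.lsmul ℝ ℝ, μ] (f - h)) x +
      (((φ k).normed μ ⋆[ContinuousLinearMap.lsmul ℝ ℝ, μ] h) x - h x) + (h x - f x) := by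
    intro x
    have hex : ∀ {g : E → F}, Integrable g μ → ConvolutionExistsAt ((φ k).normed μ) g x
        (ContinuousLinearMap.lsmul ℝ ℝ) μ := fun hg =>
      (φ k).hasCompactSupport_normed.convolutionExists_left _ (φ k).continuous_normed
        hg.locallyIntegrable x
    have : ((φ k).normed μ ⋆[ContinuousLinearMap.lsmul ℝ ℝ, μ] f) x =
      ((φ k).normed μ ⋆[ContinuousLinearMap.lsmul ℝ ℝ, μ] (f - h)) x +
      ((φ k).normed μ ⋆[ContinuousLinearMap.lsmul ℝ ℝ, μ] h) x := by
      rw [← ConvolutionExistsAt.distrib_add (hex (hf.sub hintg)) (hex hintg)]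
      simp
    rw [this]; abel
  have m1 : AEMeasurable (fun x => ‖((φ k).normed μ ⋆[ContinuousLinearMap.lsmul ℝ ℝ, μ] (f - h)) x‖ₑ) μ := by
    exact ((φ k).hasCompactSupport_normed.continuous_convolution_left _
      (φ k).continuous_normed (hf.sub hintg).locallyIntegrable).aestronglyMeasurable.enorm
  have m2 : AEMeasurable (fun x => ‖h x - f x‖ₑ) μ := (hintg.sub hf).1.enorm
  calc _ ≤ ∫⁻ x, (‖((φ k).normed μ ⋆[ContinuousLinearMap.lsmul ℝ ℝ, μ] (f - h)) x‖ₑ +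
      ‖((φ k).normed μ ⋆[ContinuousLinearMap.lsmul ℝ ℝ, μ] h) x - h x‖ₑ) + ‖h x - f x‖ₑ ∂μ := by
        gcongr with x
        rw [e1 x]
        exact (enorm_add_le _ _).trans (by gcongr; exact enorm_add_le _ _)
    _ ≤ ENNReal.ofReal (η / 3) + ENNReal.ofReal (η / 3) + ENNReal.ofReal (η / 3) := by
        rw [lintegral_add_right' _ m2, lintegral_add_left' m1]
        gcongr
        · exact (lintegral_enorm_normed_convolution_le _ (hf.sub hintg).1).trans hle'
        · simpa [enorm_sub_rev] using hle'
    _ = η := by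
        rw [← ENNReal.ofReal_add (by positivity) (by positivity),
          ← ENNReal.ofReal_add (by positivity) (by positivity)]
        ring_nf; simp
    _ ≤ ε := hηε.le

/-- The weak gradient identity on `O`, tested against test functions. -/
def WeakGradIdentity {n : ℕ} (O : Set (Euc n)) (U : Euc n → ℝ) (G : Euc n → Euc n) : Prop :=
  ∀ φ : Euc n → ℝ, ContDiff ℝ (⊤ : ℕ∞) φ → HasCompactSupport φ → tsupport φ ⊆ O →
    ∀ i : Fin n, ∫ x, U x * fderiv ℝ φ x (EuclideanSpace.single i 1) = - ∫ x, G x i * φ x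

theorem WeakGradIdentity.integral_mul_fderiv {n : ℕ} {O : Set (Euc n)} {U : Euc n → ℝ}
    {G : Euc n → Euc n} (h : WeakGradIdentity O U G) (hU : Integrable U) (hG : Integrable G)
    {φ : Euc n → ℝ} (hφ : ContDiff ℝ (⊤ : ℕ∞) φ) (hc : HasCompactSupport φ)
    (hs : tsupport φ ⊆ O) (v : Euc n) :
    ∫ x, U x * fderiv ℝ φ x v = - ∫ x, inner ℝ (G x) v * φ x := by
  have hv : v = ∑ i, v i • EuclideanSpace.single i (1 : ℝ) := by
    ext j
    simp [Finset.sum_apply, Pi.single_apply]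
  obtain ⟨C, hC⟩ := hc.exists_bound_of_continuous hφ.continuous
  have hd : Continuous (fderiv ℝ φ) := hφ.continuous_fderiv (by simp)
  obtain ⟨C', hC'⟩ := (hc.fderiv ℝ).exists_bound_of_continuous hd
  have e1 : ∀ x, U x * fderiv ℝ φ x v =
      ∑ i, v i * (U x * fderiv ℝ φ x (EuclideanSpace.single i 1)) := by
    intro x
    conv_lhs => rw [hv]
    simp only [map_sum, map_smul, smul_eq_mul, Finset.mul_sum]
    exact Finset.sum_congr rfl fun i _ => by ring
  have e2 : ∀ x, inner ℝ (G x) v * φ x = ∑ i, v i * (G x i * φ x) := by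
    intro x
    simp only [PiLp.inner_apply, Finset.sum_mul]
    exact Finset.sum_congr rfl fun i _ => by simp; ring
  simp_rw [e1, e2]
  rw [integral_finsetSum, integral_finsetSum, ← Finset.sum_neg_distrib]
  · refine Finset.sum_congr rfl fun i _ => ?_
    rw [integral_const_mul, integral_const_mul, h φ hφ hc hs i, mul_neg]
  · intro i _
    refine Integrable.const_mul ?_ _
    have hGi : Integrable (fun x => G x i) := hG.eval_piLp i
    exact hGi.mul_bdd hφ.continuous.aestronglyMeasurable (ae_of_all _ hC)
  · intro i _
    refine Integrable.const_mul ?_ _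
    refine hU.mul_bdd (c := C' * ‖EuclideanSpace.single i (1 : ℝ)‖)
      (hd.clm_apply continuous_const).aestronglyMeasurable (ae_of_all _ fun x => ?_)
    exact (ContinuousLinearMap.le_opNorm _ _).trans (by gcongr; exact hC' x)

open scoped Convolution in
theorem WeakGradIdentity.hasGradientAt_convolution {n : ℕ} {O : Set (Euc n)} {U : Euc n → ℝ}
    {G : Euc n → Euc n} (h : WeakGradIdentity O U G) (hU : Integrable U) (hG : Integrable G)
    (φ : ContDiffBump (0 : Euc n)) {x : Euc n} (hx : closedBall x φ.rOut ⊆ O) :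
    HasGradientAt (φ.normed volume ⋆[ContinuousLinearMap.lsmul ℝ ℝ] U)
      ((φ.normed volume ⋆[ContinuousLinearMap.lsmul ℝ ℝ] G) x) x := by
  set ρ : Euc n → ℝ := φ.normed volume with hρ
  have hρd : ContDiff ℝ (⊤ : ℕ∞) ρ := φ.contDiff_normed
  have hρc : HasCompactSupport ρ := φ.hasCompactSupport_normed
  have hD := hρc.hasFDerivAt_convolution_left (ContinuousLinearMap.lsmul ℝ ℝ)
    (hρd.of_le (by simp)) hU.locallyIntegrable x
  rw [hasGradientAt_iff_hasFDerivAt]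
  suffices hs : InnerProductSpace.toDual ℝ (Euc n)
      ((ρ ⋆[ContinuousLinearMap.lsmul ℝ ℝ, volume] G) x) =
      (fderiv ℝ ρ ⋆[(ContinuousLinearMap.lsmul ℝ ℝ).precompL (Euc n), volume] U) x by
    rw [hs]; exact hD
  refine ContinuousLinearMap.ext fun (v : Euc n) => ?_
  set ψ : Euc n → ℝ := fun t => ρ (x - t) with hψ
  have hψd : ContDiff ℝ (⊤ : ℕ∞) ψ := hρd.comp (contDiff_const.sub contDiff_id)
  have hψs : tsupport ψ ⊆ closedBall x φ.rOut := by
    refine closure_minimal ?_ isClosed_closedBall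
    intro t ht
    have : x - t ∈ Function.support ρ := ht
    rw [hρ, φ.support_normed_eq] at this
    rw [mem_closedBall, dist_comm, dist_eq_norm]
    simpa using (mem_ball_zero_iff.1 this).le
  have hψc : HasCompactSupport ψ :=
    HasCompactSupport.of_support_subset_isCompact (isCompact_closedBall x φ.rOut)
      ((subset_tsupport _).trans hψs)
  have hψf : ∀ t, fderiv ℝ ψ t v = - fderiv ℝ ρ (x - t) v := by
    intro t
    have h1 : HasFDerivAt ρ (fderiv ℝ ρ (x - t)) (x - t) :=
      (hρd.differentiable (by simp) _).hasFDerivAt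
    have h2 : HasFDerivAt (fun t => x - t) (-(ContinuousLinearMap.id ℝ (Euc n))) t :=
      (hasFDerivAt_id t).const_sub x
    have h3 := (h1.comp t h2).fderiv
    have h4 : fderiv ℝ ψ t = (fderiv ℝ ρ (x - t)).comp (-(ContinuousLinearMap.id ℝ (Euc n))) := h3
    simp [h4]
  have key := h.integral_mul_fderiv hU hG hψd hψc (hψs.trans hx) v
  have hex : ConvolutionExistsAt (fderiv ℝ ρ) U x
      ((ContinuousLinearMap.lsmul ℝ ℝ).precompL (Euc n)) volume :=
    (hρc.fderiv ℝ).convolutionExists_left _ (hρd.continuous_fderiv (by simp))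
        hU.locallyIntegrable x
  have hexG : ConvolutionExistsAt ρ G x (ContinuousLinearMap.lsmul ℝ ℝ) volume :=
    hρc.convolutionExists_left _ hρd.continuous hG.locallyIntegrable x
  have r1 : (fderiv ℝ ρ ⋆[(ContinuousLinearMap.lsmul ℝ ℝ).precompL (Euc n), volume] U) x v =
      ∫ t, U t * fderiv ℝ ρ (x - t) v := by
    rw [convolution_eq_swap, ContinuousLinearMap.integral_apply hex.integrable_swap]
    simp [ContinuousLinearMap.precompL_apply, mul_comm]
  have r2 : inner ℝ ((ρ ⋆[ContinuousLinearMap.lsmul ℝ ℝ, volume] G) x) v =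
      ∫ t, inner ℝ (G t) v * ψ t := by
    rw [convolution_eq_swap, real_inner_comm, ← integral_inner hexG.integrable_swap]
    refine integral_congr_ae (ae_of_all _ fun t => ?_)
    simp [hψ, inner_smul_right, real_inner_comm, mul_comm]
  rw [r1, InnerProductSpace.toDual_apply_apply, r2]
  simp_rw [hψf, mul_neg, integral_neg] at key
  linarith

open scoped Convolution in
theorem ConvexOn.map_normed_convolution_le {n : ℕ} {G : Euc n → Euc n} (hG : Integrable G)
    {F : Euc n → ℝ} (hF : ConvexOn ℝ univ F)
    (φ : ContDiffBump (0 : Euc n)) {x : Euc n} {H : Euc n → ℝ} (hH : Integrable H)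
    (hx : ∀ t ∈ closedBall x φ.rOut, F (G t) = H t) :
    F ((φ.normed volume ⋆[ContinuousLinearMap.lsmul ℝ ℝ] G) x) ≤
      (φ.normed volume ⋆[ContinuousLinearMap.lsmul ℝ ℝ] H) x := by
  set ρ : Euc n → ℝ := φ.normed volume with hρ
  have hρd : Continuous ρ := φ.continuous_normed
  have hρc : HasCompactSupport ρ := φ.hasCompactSupport_normed
  have hFc : Continuous F := continuousOn_univ.1 (hF.continuousOn isOpen_univ)
  set k : Euc n → ℝ≥0 := fun t => (ρ (x - t)).toNNReal with hk
  have hkm : Measurable k := (hρd.comp (continuous_const.sub continuous_id)).measurable.real_toNNReal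
  have hk' : ∀ t, (k t : ℝ) = ρ (x - t) := fun t => Real.coe_toNNReal _ (φ.nonneg_normed _)
  set ν : Measure (Euc n) := volume.withDensity (fun t => (k t : ℝ≥0∞)) with hν
  have hρi : Integrable ρ := φ.integrable_normed
  have hprob : IsProbabilityMeasure ν := by
    constructor
    rw [hν, withDensity_apply _ MeasurableSet.univ, Measure.restrict_univ]
    have : ∫⁻ t, (k t : ℝ≥0∞) = ∫⁻ t, ENNReal.ofReal (ρ (x - t)) := rfl
    rw [this, ← ofReal_integral_eq_lintegral_ofReal (hρi.comp_sub_left x)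
      (ae_of_all _ fun t => φ.nonneg_normed _), integral_sub_left_eq_self ρ volume x,
      φ.integral_normed]
    simp
  have hexG : ConvolutionExistsAt ρ G x (ContinuousLinearMap.lsmul ℝ ℝ) volume :=
    hρc.convolutionExists_left _ hρd hG.locallyIntegrable x
  have hexH : ConvolutionExistsAt ρ H x (ContinuousLinearMap.lsmul ℝ ℝ) volume :=
    hρc.convolutionExists_left _ hρd hH.locallyIntegrable x
  have e : ∀ t, k t • F (G t) = k t • H t := by
    intro t
    by_cases ht : t ∈ closedBall x φ.rOut
    · rw [hx t ht]
    · have : x - t ∉ Function.support ρ := by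
        rw [hρ, φ.support_normed_eq]
        intro h'
        apply ht
        rw [mem_closedBall, dist_comm, dist_eq_norm]
        simpa using (mem_ball_zero_iff.1 h').le
      have h0 : ρ (x - t) = 0 := by simpa using this
      simp [hk, h0]
  have i1 : Integrable G ν := by
    rw [hν, integrable_withDensity_iff_integrable_smul hkm]
    refine hexG.integrable_swap.congr (ae_of_all _ fun t => ?_)
    simp [← hk', NNReal.smul_def]
  have i2 : Integrable (F ∘ G) ν := by
    rw [hν, integrable_withDensity_iff_integrable_smul hkm]
    refine hexH.integrable_swap.congr (ae_of_all _ fun t => ?_)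
    simp only [Function.comp_apply, e]
    simp [← hk', NNReal.smul_def]
  have J := hF.map_integral_le (μ := ν) hFc.continuousOn isClosed_univ (by simp) i1 i2
  rw [hν, integral_withDensity_eq_integral_smul hkm, integral_withDensity_eq_integral_smul hkm] at J
  rw [convolution_eq_swap, convolution_eq_swap]
  have j1 : ∫ t, ContinuousLinearMap.lsmul ℝ ℝ (ρ (x - t)) (G t) = ∫ t, k t • G t :=
    integral_congr_ae (ae_of_all _ fun t => by simp [← hk', NNReal.smul_def])
  have j2 : ∫ t, ContinuousLinearMap.lsmul ℝ ℝ (ρ (x - t)) (H t) = ∫ t, k t • F (G t) :=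
    integral_congr_ae (ae_of_all _ fun t => by
      simp only [e]
      simp [← hk', NNReal.smul_def])
  rw [j1, j2]
  exact J

open scoped Convolution in
theorem WeakGradIdentity.exists_smooth_approx {n : ℕ} {O : Set (Euc n)} (hO : MeasurableSet O)
    {U : Euc n → ℝ} {G : Euc n → Euc n} (h : WeakGradIdentity O U G) (hU : Integrable U)
    (hG : Integrable G) {B : Set (Euc n)} (hB : MeasurableSet B) {r : ℝ} (hr : 0 < r)
    (hBO : ∀ x ∈ B, closedBall x r ⊆ O) :
    ∃ w : ℕ → Euc n → ℝ, (∀ k, ContDiff ℝ (⊤ : ℕ∞) (w k)) ∧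
      Tendsto (fun k => ∫⁻ x, ‖w k x - U x‖ₑ) atTop (𝓝 0) ∧
      Tendsto (fun k => ∫⁻ x in B, ‖gradient (w k) x - G x‖ₑ) atTop (𝓝 0) ∧
      ∀ F : Euc n → ℝ, ConvexOn ℝ univ F → (∀ v, 0 ≤ F v) →
        ∫⁻ x in O, ENNReal.ofReal (F (G x)) < ∞ → ∀ ε : ℝ≥0∞, ε ≠ 0 →
        ∀ᶠ k in atTop, ∀ S : Set (Euc n), MeasurableSet S → S ⊆ B →
          ∫⁻ x in S, ENNReal.ofReal (F (gradient (w k) x)) ≤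
            (∫⁻ x in S, ENNReal.ofReal (F (G x))) + ε := by
  have hpos : ∀ k : ℕ, 0 < r / (k + 1) := fun k => by positivity
  let φ : ℕ → ContDiffBump (0 : Euc n) := fun k =>
    ⟨r / (k + 1) / 2, r / (k + 1), half_pos (hpos k), half_lt_self (hpos k)⟩
  have hφ0 : Tendsto (fun k => (φ k).rOut) atTop (𝓝 0) := by
    have := tendsto_one_div_add_atTop_nhds_zero_nat.const_mul r
    simpa [φ, div_eq_mul_inv] using this
  have hφr : ∀ k, (φ k).rOut ≤ r := fun k => by
    show r / (k + 1) ≤ r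
    exact div_le_self hr.le (by linarith [k.cast_nonneg (α := ℝ)])
  have hball : ∀ k, ∀ x ∈ B, closedBall x (φ k).rOut ⊆ O := fun k x hx =>
    (closedBall_subset_closedBall (hφr k)).trans (hBO x hx)
  let w : ℕ → Euc n → ℝ := fun k =>
    (φ k).normed volume ⋆[ContinuousLinearMap.lsmul ℝ ℝ] U
  have hgrad : ∀ k, ∀ x ∈ B, gradient (w k) x =
      ((φ k).normed volume ⋆[ContinuousLinearMap.lsmul ℝ ℝ] G) x := fun k x hx =>
    (h.hasGradientAt_convolution hU hG (φ k) (hball k x hx)).gradient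
  refine ⟨w, fun k => ?_, tendsto_lintegral_enorm_normed_convolution_sub hφ0 hU, ?_, ?_⟩
  · exact (φ k).hasCompactSupport_normed.contDiff_convolution_left _ (φ k).contDiff_normed
      hU.locallyIntegrable
  · refine tendsto_of_tendsto_of_tendsto_of_le_of_le tendsto_const_nhds
      (tendsto_lintegral_enorm_normed_convolution_sub hφ0 hG) (fun _ => zero_le) fun k => ?_
    refine (setLIntegral_congr_fun hB fun x hx => ?_).trans_le (setLIntegral_le_lintegral B _)
    simp only [hgrad k x hx]
  · intro F hF hF0 hfin ε hε
    have hFc : Continuous F := continuousOn_univ.1 (hF.continuousOn isOpen_univ)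
    have hFG : AEStronglyMeasurable (fun x => F (G x)) volume :=
      hFc.comp_aestronglyMeasurable hG.aestronglyMeasurable
    let H : Euc n → ℝ := O.indicator fun x => F (G x)
    have hH : Integrable H := by
      rw [integrable_indicator_iff hO]
      refine ⟨hFG.restrict, ?_⟩
      rw [hasFiniteIntegral_iff_ofReal (ae_of_all _ fun x => hF0 _)]
      exact hfin
    have hlim := tendsto_lintegral_enorm_normed_convolution_sub hφ0 hH
    have hlt : ∀ᶠ k in atTop, _ < ε := hlim.eventually_lt_const (pos_iff_ne_zero.2 hε)
    filter_upwards [hlt] with k hk S hS hSB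
    have hBO' : ∀ x ∈ B, x ∈ O := fun x hx => hBO x hx (mem_closedBall_self hr.le)
    calc ∫⁻ x in S, ENNReal.ofReal (F (gradient (w k) x))
        ≤ ∫⁻ x in S, (ENNReal.ofReal (F (G x)) +
            ‖((φ k).normed volume ⋆[ContinuousLinearMap.lsmul ℝ ℝ, volume] H) x - H x‖ₑ) := by
          refine setLIntegral_mono' hS fun x hx => ?_
          rw [hgrad k x (hSB hx)]
          have hJ := ConvexOn.map_normed_convolution_le hG hF (φ k) hH (x := x) fun t ht => by
            simp [H, hball k x (hSB hx) ht]
          have hHx : H x = F (G x) := by simp [H, hBO' x (hSB hx)]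
          refine (ENNReal.ofReal_le_ofReal hJ).trans ?_
          rw [← hHx, ← ofReal_norm, ← ENNReal.ofReal_add (hHx ▸ hF0 _) (norm_nonneg _)]
          refine ENNReal.ofReal_le_ofReal ?_
          linarith [Real.le_norm_self
            (((φ k).normed volume ⋆[ContinuousLinearMap.lsmul ℝ ℝ, volume] H) x - H x)]
      _ = (∫⁻ x in S, ENNReal.ofReal (F (G x))) + ∫⁻ x in S,
            ‖((φ k).normed volume ⋆[ContinuousLinearMap.lsmul ℝ ℝ, volume] H) x - H x‖ₑ :=
          lintegral_add_left' hFG.aemeasurable.ennreal_ofReal.restrict _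
      _ ≤ _ := by
          gcongr
          exact (setLIntegral_le_lintegral S _).trans hk.le

/-- Convex growth functions `Φ` for which gradient bounds in terms of `Φ` control the
oscillation of functions of `e + 1` variables. -/
structure GrowthFn (e : ℕ) (Φ : ℝ → ℝ) : Prop where
  convex : ConvexOn ℝ univ Φ
  mono : MonotoneOn Φ (Ici 0)
  zero : Φ 0 = 0
  linear : ∃ c : ℝ, 0 < c ∧ ∀ t, 0 ≤ t → t ≤ c * Φ t
  kernel : ∃ c : ℝ≥0, ∃ b : ℝ → ℝ≥0∞, Measurable b ∧ ∫⁻ t in Ioo 0 1, b t < ∞ ∧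
    ∀ a, 0 ≤ a → ∀ t ∈ Ioo (0 : ℝ) 1,
      ENNReal.ofReal a ≤ c * ENNReal.ofReal (t ^ e * Φ a) + b t

theorem GrowthFn.nonneg {e : ℕ} {Φ : ℝ → ℝ} (h : GrowthFn e Φ) {t : ℝ} (ht : 0 ≤ t) :
    0 ≤ Φ t := by
  have := h.mono (mem_Ici.2 le_rfl) (mem_Ici.2 ht) ht
  rwa [h.zero] at this

theorem GrowthFn.continuous {e : ℕ} {Φ : ℝ → ℝ} (h : GrowthFn e Φ) : Continuous Φ :=
  continuousOn_univ.1 (h.convex.continuousOn isOpen_univ)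

theorem GrowthFn.comp_div {e : ℕ} {Φ : ℝ → ℝ} (h : GrowthFn e Φ) {s : ℝ} (hs : 0 < s) :
    GrowthFn e fun t => Φ (t / s) where
  convex := by
    refine ⟨convex_univ, fun x _ y _ a b ha hb hab => ?_⟩
    have := h.convex.2 (mem_univ (x / s)) (mem_univ (y / s)) ha hb hab
    convert this using 2
    simp only [smul_eq_mul]
    ring
  mono x hx y hy hxy := h.mono (mem_Ici.2 (div_nonneg hx hs.le))
    (mem_Ici.2 (div_nonneg hy hs.le)) (by gcongr)
  zero := by simp [h.zero]
  linear := by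
    obtain ⟨c, hc, H⟩ := h.linear
    refine ⟨s * c, by positivity, fun t ht => ?_⟩
    have := H (t / s) (div_nonneg ht hs.le)
    rw [div_le_iff₀ hs] at this
    linarith
  kernel := by
    obtain ⟨c, b, hb, hb1, H⟩ := h.kernel
    refine ⟨s.toNNReal * c, fun t => ENNReal.ofReal s * b t, hb.const_mul _, ?_, ?_⟩
    · rw [lintegral_const_mul _ hb]
      exact ENNReal.mul_lt_top ENNReal.ofReal_lt_top hb1
    · intro a ha t ht
      have := H (a / s) (div_nonneg ha hs.le) t ht
      have e1 : ENNReal.ofReal a = ENNReal.ofReal s * ENNReal.ofReal (a / s) := by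
        rw [← ENNReal.ofReal_mul hs.le, mul_div_cancel₀ _ hs.ne']
      rw [e1]
      refine (mul_le_mul_right this _).trans ?_
      rw [mul_add, ← mul_assoc, ENNReal.coe_mul]
      rfl

theorem GrowthFn.abs : GrowthFn 0 fun t => |t| where
  convex := convexOn_univ_norm (E := ℝ)
  mono x hx y hy hxy := by
    show |x| ≤ |y|
    rwa [abs_of_nonneg hx, abs_of_nonneg hy]
  zero := abs_zero
  linear := ⟨1, one_pos, fun t _ => by rw [one_mul]; exact le_abs_self t⟩
  kernel := by
    refine ⟨1, fun _ => 0, measurable_const, by simp, fun a ha t ht => ?_⟩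
    simp [abs_of_nonneg ha]

theorem growthFn_pow_add_abs (e : ℕ) : GrowthFn e fun t => t ^ (2 * e + 2) + |t| where
  convex := (Even.convexOn_pow ⟨e + 1, by ring⟩).add (convexOn_univ_norm (E := ℝ))
  mono x hx y hy hxy := by
    have hx : 0 ≤ x := hx
    have hy : 0 ≤ y := hy
    simp only [abs_of_nonneg hx, abs_of_nonneg hy]
    gcongr
  zero := by simp
  linear := by
    refine ⟨1, one_pos, fun t ht => ?_⟩
    have : 0 ≤ t ^ (2 * e + 2) := by positivity
    rw [one_mul]
    linarith [le_abs_self t]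
  kernel := by
    refine ⟨1, fun t => ENNReal.ofReal (t ^ (-(1 / 2) : ℝ)), by fun_prop, ?_, ?_⟩
    · have : IntegrableOn (fun t : ℝ => t ^ (-(1 / 2) : ℝ)) (Ioo 0 1) :=
        (intervalIntegral.integrableOn_Ioo_rpow_iff one_pos).2 (by norm_num)
      exact (hasFiniteIntegral_iff_ofReal ((ae_restrict_mem measurableSet_Ioo).mono
        fun t ht => Real.rpow_nonneg ht.1.le _)).1 this.2
    · intro a ha t ht
      rcases le_or_gt a (t ^ (-(1 / 2) : ℝ)) with h | h
      · exact (ENNReal.ofReal_le_ofReal h).trans le_add_self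
      · refine le_trans ?_ le_self_add
        simp only [ENNReal.coe_one, one_mul]
        refine ENNReal.ofReal_le_ofReal ?_
        have h0 := ht.1
        have hp : 0 < t ^ (-(1 / 2) : ℝ) := Real.rpow_pos_of_pos h0 _
        have h1 : 1 ≤ t * a ^ 2 := by
          have : (t ^ (-(1 / 2) : ℝ)) ^ 2 ≤ a ^ 2 := by gcongr
          rw [← Real.rpow_natCast, ← Real.rpow_mul h0.le] at this
          norm_num [Real.rpow_neg_one] at this
          calc 1 = t * t⁻¹ := (mul_inv_cancel₀ h0.ne').symm
            _ ≤ _ := by gcongr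
        have h2 : 1 ≤ a := by
          by_contra hlt
          push Not at hlt
          have : t * a ^ 2 < 1 := by nlinarith [ht.2, sq_nonneg a]
          linarith
        have h3 : 1 ≤ (t * a ^ 2) ^ e := one_le_pow₀ h1
        have h4 : t ^ e * (a ^ (2 * e + 2) + |a|) = (t * a ^ 2) ^ e * a ^ 2 + t ^ e * |a| := by
          rw [pow_add, pow_mul, mul_pow]
          ring
        rw [h4]
        have : 0 ≤ t ^ e * |a| := by positivity
        nlinarith [sq_nonneg a]

theorem IsYoung.map_mul_le {A : ℝ → ℝ≥0∞} (hA : IsYoung A) {l x : ℝ} (hl : 0 ≤ l) (hl1 : l ≤ 1)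
    (hx : 0 ≤ x) : A (l * x) ≤ ENNReal.ofReal l * A x := by
  simpa [hA.1] using hA.2.1 hx le_rfl hl hl1

theorem IsYoung.mono {A : ℝ → ℝ≥0∞} (hA : IsYoung A) {x y : ℝ} (hx : 0 ≤ x) (hxy : x ≤ y) :
    A x ≤ A y := by
  rcases eq_or_lt_of_le (hx.trans hxy) with h | h
  · have : x = y := le_antisymm hxy (h ▸ hx)
    rw [this]
  · have := hA.map_mul_le (div_nonneg hx h.le) ((div_le_one h).2 hxy) h.le
    rw [div_mul_cancel₀ _ h.ne'] at this
    refine this.trans (mul_le_of_le_one_left' ?_)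
    exact ENNReal.ofReal_le_one.2 ((div_le_one h).2 hxy)

theorem IsYoung.convexOn_toReal {A : ℝ → ℝ≥0∞} (hA : IsYoung A)
    (hfin : ∀ t, 0 ≤ t → A t ≠ ∞) : ConvexOn ℝ univ fun t : ℝ => (A |t|).toReal := by
  refine ⟨convex_univ, fun x _ y _ a b ha hb hab => ?_⟩
  obtain rfl : b = 1 - a := by linarith
  simp only [smul_eq_mul]
  have h1 : A |a * x + (1 - a) * y| ≤ A (a * |x| + (1 - a) * |y|) := by
    refine hA.mono (abs_nonneg _) ((abs_add_le _ _).trans_eq ?_)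
    rw [abs_mul, abs_mul, abs_of_nonneg ha, abs_of_nonneg hb]
  have h2 := h1.trans (hA.2.1 (abs_nonneg x) (abs_nonneg y) ha (by linarith))
  have hx := hfin _ (abs_nonneg x)
  have hy := hfin _ (abs_nonneg y)
  have h3 := ENNReal.toReal_mono (ENNReal.add_ne_top.2
    ⟨ENNReal.mul_ne_top ENNReal.ofReal_ne_top hx, ENNReal.mul_ne_top ENNReal.ofReal_ne_top hy⟩) h2
  rwa [ENNReal.toReal_add (ENNReal.mul_ne_top ENNReal.ofReal_ne_top hx)
    (ENNReal.mul_ne_top ENNReal.ofReal_ne_top hy), ENNReal.toReal_mul, ENNReal.toReal_mul,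
    ENNReal.toReal_ofReal ha, ENNReal.toReal_ofReal hb] at h3

theorem IsYoung.growthFn {e : ℕ} (he : 1 ≤ e) {A : ℝ → ℝ≥0∞} (hA : IsYoung A)
    (hfin : ∀ t, 0 ≤ t → A t ≠ ∞) (hT : TailCondition (e + 2) A) :
    GrowthFn e fun t => (A |t|).toReal + |t| := by
  have hconv := (hA.convexOn_toReal hfin).add (convexOn_univ_norm (E := ℝ))
  have hcont : Continuous fun t : ℝ => (A |t|).toReal + |t| :=
    continuousOn_univ.1 (hconv.continuousOn isOpen_univ)
  refine ⟨hconv, ?_, by simp [hA.1], ⟨1, one_pos, fun t ht => ?_⟩, ?_⟩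
  · intro x hx y hy hxy
    have hx : 0 ≤ x := hx
    have hy : 0 ≤ y := hy
    simp only [abs_of_nonneg hx, abs_of_nonneg hy]
    exact add_le_add (ENNReal.toReal_mono (hfin y hy) (hA.mono hx hxy)) hxy
  · have : 0 ≤ (A |t|).toReal := ENNReal.toReal_nonneg
    rw [one_mul]
    linarith [le_abs_self t]
  · set Φ : ℝ → ℝ := fun t : ℝ => (A |t|).toReal + |t| with hΦ
    let T : Set (ℝ × ℝ) := {p | p.1 ^ e * Φ p.2 < p.2}
    have hTm : MeasurableSet T :=
      measurableSet_lt (by fun_prop) measurable_snd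
    let b : ℝ → ℝ≥0∞ := fun t => volume.restrict (Ioi (0 : ℝ)) (Prod.mk t ⁻¹' T)
    have he0 : (e : ℝ) ≠ 0 := by positivity
    refine ⟨1, b, measurable_measure_prodMk_left hTm, ?_, ?_⟩
    · obtain ⟨t₀, ht₀, hI⟩ := hT
      have e1 : ∫⁻ t in Ioo 0 1, b t =
          ∫⁻ s in Ioi (0 : ℝ), volume.restrict (Ioo (0 : ℝ) 1) ((fun t => (t, s)) ⁻¹' T) := by
        rw [← Measure.prod_apply hTm, Measure.prod_apply_symm hTm]
      have hexp : 1 / (((e + 2 : ℕ) : ℝ) - 2) = 1 / (e : ℝ) := by push_cast; ring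
      rw [hexp] at hI
      have hsec : ∀ s, 0 < s → volume.restrict (Ioo (0 : ℝ) 1) ((fun t => (t, s)) ⁻¹' T) ≤
          (ENNReal.ofReal s / A s) ^ (1 / (e : ℝ)) := by
        intro s hs
        have hm : MeasurableSet ((fun t : ℝ => (t, s)) ⁻¹' T) :=
          measurable_prodMk_right hTm
        rw [Measure.restrict_apply hm]
        set X := (ENNReal.ofReal s / A s) ^ (1 / (e : ℝ)) with hX
        have hsub : ((fun t : ℝ => (t, s)) ⁻¹' T) ∩ Ioo 0 1 ⊆
            {t | 0 < t ∧ ENNReal.ofReal t ≤ X} := by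
          rintro t ⟨ht, ht1⟩
          have ht : t ^ e * Φ s < s := ht
          refine ⟨ht1.1, ?_⟩
          have : ENNReal.ofReal t ^ (e : ℝ) ≤ ENNReal.ofReal s / A s := by
            rw [ENNReal.le_div_iff_mul_le (Or.inr (by simpa using hs)) (Or.inl (hfin s hs.le)),
              ENNReal.rpow_natCast, ← ENNReal.ofReal_pow ht1.1.le,
              ← ENNReal.ofReal_toReal (hfin s hs.le), ← ENNReal.ofReal_mul (by positivity [ht1.1])]
            refine ENNReal.ofReal_le_ofReal (le_trans ?_ ht.le)
            have h0 : 0 ≤ t ^ e := pow_nonneg ht1.1.le _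
            refine mul_le_mul_of_nonneg_left ?_ h0
            simp only [hΦ, abs_of_pos hs]
            linarith
          have h2 := ENNReal.rpow_le_rpow this (z := 1 / (e : ℝ)) (by positivity)
          rwa [← ENNReal.rpow_mul, mul_one_div_cancel he0, ENNReal.rpow_one] at h2
        refine (measure_mono hsub).trans ?_
        by_cases hXt : X = ∞
        · rw [hXt]; exact le_top
        · have : {t : ℝ | 0 < t ∧ ENNReal.ofReal t ≤ X} ⊆ Ioc 0 X.toReal := by
            rintro t ⟨h1, h2⟩
            exact ⟨h1, (ENNReal.ofReal_le_iff_le_toReal hXt).1 h2⟩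
          refine (measure_mono this).trans ?_
          rw [Real.volume_Ioc, sub_zero, ENNReal.ofReal_toReal hXt]
      rw [e1, ← Ioc_union_Ioi_eq_Ioi ht₀.le]
      refine (lintegral_union_le _ _ _).trans_lt (ENNReal.add_lt_top.2 ⟨?_, ?_⟩)
      · calc _ ≤ ∫⁻ s in Ioc 0 t₀, 1 := by
              refine lintegral_mono fun s => ?_
              refine (measure_mono (subset_univ _)).trans ?_
              simp
          _ < ∞ := by simp
      · refine lt_of_le_of_lt (setLIntegral_mono' measurableSet_Ioi fun s hs => ?_) hI
        exact hsec s (ht₀.trans hs)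
    · intro a ha t ht
      rw [ENNReal.coe_one, one_mul]
      rcases le_or_gt a (t ^ e * Φ a) with h | h
      · exact (ENNReal.ofReal_le_ofReal h).trans le_self_add
      · refine le_trans ?_ le_add_self
        have hsub : Ioc 0 a ⊆ Prod.mk t ⁻¹' T := by
          intro s hs
          show t ^ e * Φ s < s
          have ha0 : 0 < a := hs.1.trans_le hs.2
          have hc := hconv.2 (mem_univ a) (mem_univ 0) (div_nonneg hs.1.le ha)
            (sub_nonneg.2 ((div_le_one ha0).2 hs.2)) (by ring)
          have hz : Φ 0 = 0 := by simp [hΦ, hA.1]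
          have hc' : Φ s ≤ s / a * Φ a := by
            have h5 : Φ (s / a * a + (1 - s / a) * 0) ≤ s / a * Φ a + (1 - s / a) * Φ 0 := hc
            rwa [hz, mul_zero, add_zero, add_zero, div_mul_cancel₀ _ ha0.ne'] at h5
          have h0 : 0 ≤ t ^ e := pow_nonneg ht.1.le _
          calc t ^ e * Φ s ≤ t ^ e * (s / a * Φ a) := by gcongr
            _ = s / a * (t ^ e * Φ a) := by ring
            _ < s / a * a := by
              have := div_pos hs.1 ha0
              gcongr
            _ = s := div_mul_cancel₀ _ ha0.ne'
        calc ENNReal.ofReal a = volume.restrict (Ioi (0 : ℝ)) (Ioc 0 a) := by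
              rw [Measure.restrict_apply measurableSet_Ioc,
                inter_eq_left.2 Ioc_subset_Ioi_self, Real.volume_Ioc, sub_zero]
          _ ≤ b t := measure_mono hsub

theorem exists_growthFn {e : ℕ} {Ω : Set (Euc (e + 2))} {A : ℝ → ℝ≥0∞} (hA : IsYoung A)
    (hT : 3 ≤ e + 2 → TailCondition (e + 2) A) {u : Euc (e + 2) → ℝ}
    {g : Euc (e + 2) → Euc (e + 2)} (hu : MemW1Aloc A Ω u g) :
    ∃ Φ : ℝ → ℝ, GrowthFn e Φ ∧ ∀ Ω' : Set (Euc (e + 2)), IsOpen Ω' → IsCompact (closure Ω') →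
      closure Ω' ⊆ Ω → ∃ s : ℝ, 0 < s ∧ ∫⁻ x in Ω', ENNReal.ofReal (Φ (‖g x‖ / s)) < ∞ := by
  have hintg : ∀ Ω' : Set (Euc (e + 2)), IsCompact (closure Ω') → closure Ω' ⊆ Ω →
      IntegrableOn (fun x => ‖g x‖) Ω' := fun Ω' h1 h2 =>
    (hu.1.2.1.integrableOn_compact_subset h2 h1).mono_set subset_closure
  have hlt : ∀ Ω' : Set (Euc (e + 2)), IsCompact (closure Ω') → closure Ω' ⊆ Ω → ∀ s : ℝ, 0 < s →
      ∫⁻ x in Ω', ENNReal.ofReal |‖g x‖ / s| < ∞ := by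
    intro Ω' h1 h2 s hs
    have := ((hintg Ω' h1 h2).div_const s).2
    rw [hasFiniteIntegral_iff_norm] at this
    exact this
  rcases Nat.eq_zero_or_pos e with rfl | he
  · refine ⟨_, GrowthFn.abs, fun Ω' _ h1 h2 => ⟨1, one_pos, hlt Ω' h1 h2 1 one_pos⟩⟩
  by_cases hfin : ∀ t, 0 ≤ t → A t ≠ ∞
  · refine ⟨_, hA.growthFn he hfin (hT (by lia)), fun Ω' h0 h1 h2 => ?_⟩
    obtain ⟨s, hs, H⟩ := (hu.2 Ω' h0 h1 h2).2
    refine ⟨s, hs, ?_⟩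
    have hm : AEMeasurable (fun x => ENNReal.ofReal |‖g x‖ / s|) (volume.restrict Ω') := by
      have := ((hintg Ω' h1 h2).div_const s).aestronglyMeasurable.aemeasurable
      exact (continuous_abs.measurable.comp_aemeasurable this).ennreal_ofReal
    calc ∫⁻ x in Ω', ENNReal.ofReal ((A |‖g x‖ / s|).toReal + |‖g x‖ / s|)
        ≤ ∫⁻ x in Ω', (A (|‖g x‖| / s) + ENNReal.ofReal |‖g x‖ / s|) := by
          refine lintegral_mono fun x => ?_
          rw [ENNReal.ofReal_add ENNReal.toReal_nonneg (abs_nonneg _),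
            ENNReal.ofReal_toReal (hfin _ (abs_nonneg _)), abs_div, abs_of_pos hs]
      _ = (∫⁻ x in Ω', A (|‖g x‖| / s)) + ∫⁻ x in Ω', ENNReal.ofReal |‖g x‖ / s| :=
          lintegral_add_right' _ hm
      _ < ∞ := ENNReal.add_lt_top.2 ⟨H, hlt Ω' h1 h2 s hs⟩
  · push Not at hfin
    obtain ⟨t₁, ht₁, hA₁⟩ := hfin
    refine ⟨_, growthFn_pow_add_abs e, fun Ω' h0 h1 h2 => ?_⟩
    obtain ⟨s, hs, H⟩ := (hu.2 Ω' h0 h1 h2).2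
    refine ⟨s, hs, ?_⟩
    have hm : AEMeasurable (fun x => ‖g x‖ / s) (volume.restrict Ω') :=
      ((hintg Ω' h1 h2).div_const s).aestronglyMeasurable.aemeasurable
    have hind : AEMeasurable (fun x => (Ici t₁).indicator (fun _ : ℝ => (∞ : ℝ≥0∞)) (‖g x‖ / s))
        (volume.restrict Ω') :=
      (measurable_const.indicator measurableSet_Ici).comp_aemeasurable hm
    have hI : ∫⁻ x in Ω', (Ici t₁).indicator (fun _ : ℝ => (∞ : ℝ≥0∞)) (‖g x‖ / s) < ∞ := by
      refine lt_of_le_of_lt (lintegral_mono fun x => ?_) H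
      by_cases hx : t₁ ≤ ‖g x‖ / s
      · rw [indicator_of_mem (mem_Ici.2 hx), ← hA₁, abs_norm]
        exact hA.mono ht₁ hx
      · rw [indicator_of_notMem (by simpa using hx)]
        exact zero_le
    have hae : ∀ᵐ x ∂volume.restrict Ω', ‖g x‖ / s < t₁ := by
      filter_upwards [ae_lt_top' hind hI.ne] with x hx
      by_contra hcon
      rw [indicator_of_mem (by simpa using hcon)] at hx
      exact lt_irrefl _ hx
    calc ∫⁻ x in Ω', ENNReal.ofReal ((‖g x‖ / s) ^ (2 * e + 2) + |‖g x‖ / s|)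
        ≤ ∫⁻ _ in Ω', ENNReal.ofReal (t₁ ^ (2 * e + 2) + t₁) := by
          refine lintegral_mono_ae (hae.mono fun x hx => ENNReal.ofReal_le_ofReal ?_)
          have h0 : 0 ≤ ‖g x‖ / s := by positivity
          rw [abs_of_nonneg h0]
          gcongr
      _ < ∞ := by
          rw [lintegral_const, Measure.restrict_apply_univ]
          exact ENNReal.mul_lt_top ENNReal.ofReal_lt_top
            ((measure_mono subset_closure).trans_lt h1.measure_lt_top)

theorem IsWeakGradOn.exists_locallyIntegrableOn {n : ℕ} {Ω : Set (Euc n)} (hΩ : IsOpen Ω)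
    {u : Euc n → ℝ} {g : Euc n → Euc n} (h : IsWeakGradOn Ω u g) :
    ∃ G : Euc n → Euc n, (∀ x, ‖G x‖ ≤ ‖g x‖) ∧ LocallyIntegrableOn G Ω ∧
      WeakGradIdentity Ω u G := by
  classical
  obtain ⟨hu, hg, hw⟩ := h
  let T : Set (Euc n → ℝ) :=
    {φ | ContDiff ℝ (⊤ : ℕ∞) φ ∧ HasCompactSupport φ ∧ tsupport φ ⊆ Ω}
  let P : Fin n → Prop := fun i => ∀ φ ∈ T, AEStronglyMeasurable (fun x => g x i * φ x)
  let G : Euc n → Euc n := fun x => WithLp.toLp 2 fun i => if P i then g x i else 0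
  have hGi : ∀ x i, G x i = if P i then g x i else 0 := fun x i => rfl
  have hnorm : ∀ x, ‖G x‖ ≤ ‖g x‖ := by
    intro x
    rw [EuclideanSpace.norm_eq, EuclideanSpace.norm_eq]
    refine Real.sqrt_le_sqrt (Finset.sum_le_sum fun i _ => ?_)
    rw [hGi]
    split_ifs <;> simp [sq_nonneg]
  have hintg : ∀ φ ∈ T, ∀ i, Integrable
      (fun x => u x * fderiv ℝ φ x (EuclideanSpace.single i 1)) := by
    rintro φ ⟨h1, h2, h3⟩ i
    have hc : Continuous fun x => fderiv ℝ φ x (EuclideanSpace.single i 1) :=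
      (h1.continuous_fderiv (by simp)).clm_apply continuous_const
    have hK : IntegrableOn u (tsupport φ) := hu.integrableOn_compact_subset h3 h2
    have h4 : IntegrableOn (fun x => u x * fderiv ℝ φ x (EuclideanSpace.single i 1))
        (tsupport φ) := hK.mul_continuousOn hc.continuousOn h2
    rw [← integrableOn_iff_integrable_of_support_subset (s := tsupport φ)]
    · exact h4
    · intro x hx
      by_contra hx'
      apply hx
      have : fderiv ℝ φ x = 0 := by
        by_contra h0
        exact hx' (support_fderiv_subset ℝ h0)
      simp [this]
  refine ⟨G, hnorm, ?_, ?_⟩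
  · intro p hp
    obtain ⟨R, hR, hRΩ⟩ := Metric.isOpen_iff.1 hΩ p hp
    let b : ContDiffBump p := ⟨R / 3, R / 2, by positivity, by linarith⟩
    have hb : (b : Euc n → ℝ) ∈ T :=
      ⟨b.contDiff, b.hasCompactSupport, by
        rw [b.tsupport_eq]
        exact (closedBall_subset_ball (by show R / 2 < R; linarith)).trans hRΩ⟩
    refine ⟨closedBall p (R / 3), mem_nhdsWithin_of_mem_nhds (closedBall_mem_nhds _ (by positivity)),
      ?_⟩
    have hgi : IntegrableOn (fun x => ‖g x‖) (closedBall p (R / 3)) :=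
      hg.integrableOn_compact_subset
        ((closedBall_subset_ball (by linarith)).trans hRΩ) (isCompact_closedBall _ _)
    refine Integrable.mono hgi ?_ (ae_of_all _ fun x => by simpa using hnorm x)
    have hm : AEMeasurable (fun x => fun i => G x i) (volume.restrict (closedBall p (R / 3))) := by
      rw [aemeasurable_pi_iff]
      intro i
      simp only [hGi]
      by_cases hP : P i
      · simp only [hP, if_true]
        refine (hP _ hb).restrict.aemeasurable.congr ?_
        filter_upwards [ae_restrict_mem isClosed_closedBall.measurableSet] with x hx
        simp [b.one_of_mem_closedBall hx]
      · simp only [hP, if_false]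
        exact aemeasurable_const
    exact ((PiLp.continuous_toLp 2 (fun _ : Fin n => ℝ)).measurable.comp_aemeasurable
      hm).aestronglyMeasurable
  · intro φ h1 h2 h3 i
    simp only [hGi]
    by_cases hP : P i
    · simp only [hP, if_true]
      exact hw φ h1 h2 h3 i
    simp only [hP, if_false, zero_mul, integral_zero, neg_zero]
    have hzero : ∀ ψ ∈ T, ¬ AEStronglyMeasurable (fun x => g x i * ψ x) →
        ∫ x, u x * fderiv ℝ ψ x (EuclideanSpace.single i 1) = 0 := by
      rintro ψ ⟨a1, a2, a3⟩ hn
      rw [hw ψ a1 a2 a3 i, integral_undef fun hI => hn hI.aestronglyMeasurable, neg_zero]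
    have hφT : φ ∈ T := ⟨h1, h2, h3⟩
    by_cases hm : AEStronglyMeasurable (fun x => g x i * φ x)
    · obtain ⟨ψ, hψ, hψm⟩ : ∃ ψ ∈ T, ¬ AEStronglyMeasurable (fun x => g x i * ψ x) := by
        by_contra hcon
        push Not at hcon
        exact hP hcon
      have hadd : φ + ψ ∈ T := by
        refine ⟨h1.add hψ.1, h2.add hψ.2.1, ?_⟩
        refine (tsupport_add φ ψ).trans (union_subset h3 hψ.2.2)
      have hn : ¬ AEStronglyMeasurable (fun x => g x i * (φ + ψ) x) := by
        intro hs
        apply hψm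
        refine (hs.sub hm).congr (ae_of_all _ fun x => ?_)
        simp only [Pi.sub_apply, Pi.add_apply]
        ring
      have e := hzero _ hadd hn
      have e2 := hzero _ hψ hψm
      have hfd : ∀ x, fderiv ℝ (φ + ψ) x = fderiv ℝ φ x + fderiv ℝ ψ x := fun x =>
        fderiv_add (h1.differentiable (by simp) x) (hψ.1.differentiable (by simp) x)
      simp only [hfd, add_apply, mul_add] at e
      rw [integral_add (hintg φ hφT i) (hintg ψ hψ i), e2, add_zero] at e
      exact e
    · exact hzero φ hφT hm

theorem memW110_of_tendsto {n : ℕ} {Q : Set (Euc n)} {v : Euc n → ℝ}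
    {h : Euc n → Euc n} (hv : IntegrableOn v Q) (hh : IntegrableOn h Q)
    {φ : ℕ → Euc n → ℝ} (hφ : ∀ k, ContDiff ℝ (⊤ : ℕ∞) (φ k)) (hφc : ∀ k, HasCompactSupport (φ k))
    (hφs : ∀ k, tsupport (φ k) ⊆ Q)
    (h1 : Tendsto (fun k => ∫⁻ x in Q, ‖φ k x - v x‖ₑ) atTop (𝓝 0))
    (h2 : Tendsto (fun k => ∫⁻ x in Q, ‖gradient (φ k) x - h x‖ₑ) atTop (𝓝 0)) :
    MemW110 Q v := by
  have hd : ∀ k, Differentiable ℝ (φ k) := fun k => (hφ k).differentiable (by simp)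
  have hgc : ∀ k, Continuous (gradient (φ k)) := fun k =>
    (InnerProductSpace.toDual ℝ (Euc n)).symm.continuous.comp ((hφ k).continuous_fderiv (by simp))
  have hg : ∀ k x i, gradient (φ k) x i = fderiv ℝ (φ k) x (EuclideanSpace.single i 1) := by
    intro k x i
    have := InnerProductSpace.toDual_symm_apply (𝕜 := ℝ) (E := Euc n)
      (x := EuclideanSpace.single i 1) (y := fderiv ℝ (φ k) x)
    rw [← this, EuclideanSpace.inner_single_right]
    simp [gradient]
  have hi : ∀ k, Integrable (φ k) := fun k => (hφ k).continuous.integrable_of_hasCompactSupport (hφc k)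
  have hgi : ∀ k, Integrable (gradient (φ k)) := fun k => by
    refine (hgc k).integrable_of_hasCompactSupport ((hφc k).fderiv ℝ |>.mono' ?_)
    intro x hx
    refine subset_tsupport _ fun h0 => hx ?_
    simp [gradient, h0]
  refine ⟨h, ⟨hv.locallyIntegrableOn, IntegrableOn.locallyIntegrableOn (Integrable.norm hh), ?_⟩, φ,
    fun k => ⟨hφ k, hφc k, hφs k⟩, ?_⟩
  · intro ψ a1 a2 a3 i
    set D : Euc n → ℝ := fun x => fderiv ℝ ψ x (EuclideanSpace.single i 1) with hD
    have hDc : Continuous D := (a1.continuous_fderiv (by simp)).clm_apply continuous_const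
    have hψsupp : ∀ x, x ∉ Q → ψ x = 0 := fun x hx => by
      by_contra h0
      exact hx (a3 (subset_tsupport _ h0))
    have hDsupp : ∀ x, D x ≠ 0 → x ∈ tsupport ψ := fun x hx => by
      refine support_fderiv_subset ℝ fun h0 => hx ?_
      simp [hD, h0]
    have hDcs : HasCompactSupport D := by
      refine a2.mono' fun x hx => ?_
      exact hDsupp x hx
    obtain ⟨C1, hC1⟩ := a2.exists_bound_of_continuous a1.continuous
    obtain ⟨C2, hC2⟩ := hDcs.exists_bound_of_continuous hDc
    have lim : ∀ (f : Euc n → ℝ) (F : ℕ → Euc n → ℝ) (θ : Euc n → ℝ) (C : ℝ),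
        IntegrableOn f Q → (∀ k, IntegrableOn (F k) Q) → Continuous θ → (∀ x, ‖θ x‖ ≤ C) →
        (∀ x, x ∉ Q → θ x = 0) → Tendsto (fun k => ∫⁻ x in Q, ‖F k x - f x‖ₑ) atTop (𝓝 0) →
        Tendsto (fun k => ∫ x, F k x * θ x) atTop (𝓝 (∫ x, f x * θ x)) := by
      intro f F θ C hf hF hθ hC h0 hlim
      have e : ∀ f : Euc n → ℝ, ∫ x, f x * θ x = ∫ x in Q, f x * θ x := fun f =>
        (setIntegral_eq_integral_of_forall_compl_eq_zero fun x hx => by rw [h0 x hx, mul_zero]).symm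
      simp_rw [e]
      refine tendsto_integral_of_L1 _
        (hf.mul_bdd hθ.aestronglyMeasurable (ae_of_all _ hC)).aestronglyMeasurable
        (Eventually.of_forall fun k =>
        (hF k).mul_bdd hθ.aestronglyMeasurable (ae_of_all _ hC)) ?_
      have hz : Tendsto (fun k => ENNReal.ofReal C * ∫⁻ x in Q, ‖F k x - f x‖ₑ) atTop (𝓝 0) := by
        simpa using ENNReal.Tendsto.const_mul hlim (Or.inr ENNReal.ofReal_ne_top)
      refine tendsto_of_tendsto_of_tendsto_of_le_of_le tendsto_const_nhds hz
        (fun _ => zero_le) fun k => ?_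
      rw [← lintegral_const_mul' _ _ ENNReal.ofReal_ne_top]
      refine lintegral_mono fun x => ?_
      rw [← sub_mul, enorm_mul, mul_comm]
      gcongr
      rw [← ofReal_norm]
      exact ENNReal.ofReal_le_ofReal (hC x)
    have L1 := lim v φ D C2 hv (fun k => (hi k).integrableOn) hDc hC2 (fun x hx => by
      by_contra h0
      exact hx (a3 (hDsupp x h0))) h1
    have L2 := lim (fun x => h x i) (fun k x => gradient (φ k) x i) ψ C1
      (hh.eval_piLp i) (fun k => ((hgi k).eval_piLp i).integrableOn) a1.continuous hC1 hψsupp (by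
        refine tendsto_of_tendsto_of_tendsto_of_le_of_le tendsto_const_nhds h2
          (fun _ => zero_le) fun k => lintegral_mono fun x => ?_
        rw [← ofReal_norm, ← ofReal_norm]
        exact ENNReal.ofReal_le_ofReal (PiLp.norm_apply_le (gradient (φ k) x - h x) i))
    have ibp : ∀ k, ∫ x, φ k x * D x = - ∫ x, gradient (φ k) x i * ψ x := by
      intro k
      simp_rw [hg]
      refine integral_mul_fderiv_eq_neg_fderiv_mul_of_integrable ?_ ?_ ?_ (fun x _ => hd k x)
        fun x _ => a1.differentiable (by simp) x
      · simp_rw [← hg]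
        exact ((hgi k).eval_piLp i).mul_bdd a1.continuous.aestronglyMeasurable (ae_of_all _ hC1)
      · exact (hi k).mul_bdd hDc.aestronglyMeasurable (ae_of_all _ hC2)
      · exact (hi k).mul_bdd a1.continuous.aestronglyMeasurable (ae_of_all _ hC1)
    simp_rw [ibp] at L1
    exact tendsto_nhds_unique L1 L2.neg
  · have hsum := h1.add h2
    rw [add_zero] at hsum
    have hR := (ENNReal.tendsto_toReal ENNReal.zero_ne_top).comp hsum
    refine squeeze_zero_norm' ?_ hR
    have hev : ∀ᶠ k in atTop, (∫⁻ x in Q, ‖φ k x - v x‖ₑ) +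
        ∫⁻ x in Q, ‖gradient (φ k) x - h x‖ₑ < ∞ := hsum.eventually_lt_const (by simp)
    filter_upwards [hev] with k hk
    refine (norm_integral_le_lintegral_norm _).trans (ENNReal.toReal_mono hk.ne ?_)
    show _ ≤ (∫⁻ x in Q, ‖φ k x - v x‖ₑ) + ∫⁻ x in Q, ‖gradient (φ k) x - h x‖ₑ
    rw [← lintegral_add_left']
    · refine lintegral_mono fun x => ?_
      rw [Real.norm_of_nonneg (by positivity), ENNReal.ofReal_add (abs_nonneg _) (norm_nonneg _),
        ← Real.norm_eq_abs, ofReal_norm, ofReal_norm]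
    · exact ((hi k).integrableOn.aestronglyMeasurable.sub hv.aestronglyMeasurable).enorm

theorem exists_smooth_ramp : ∃ σ : ℝ → ℝ, ContDiff ℝ (⊤ : ℕ∞) σ ∧ (∀ s ≤ 0, σ s = 0) ∧
    (∀ s, |σ s - max s 0| ≤ 1) ∧ (∃ C, ∀ s, |deriv σ s| ≤ C) ∧
    (∀ s < 0, deriv σ s = 0) ∧ ∀ s, 1 < s → deriv σ s = 1 := by
  let σ : ℝ → ℝ := fun s => s * Real.smoothTransition s
  have hσ : ContDiff ℝ (⊤ : ℕ∞) σ := contDiff_id.mul Real.smoothTransition.contDiff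
  have h0 : ∀ s ≤ 0, σ s = 0 := fun s hs => by
    simp [σ, Real.smoothTransition.zero_of_nonpos hs]
  have h1 : ∀ s, 1 ≤ s → σ s = s := fun s hs => by
    simp [σ, Real.smoothTransition.one_of_one_le hs]
  have d0 : ∀ s < 0, deriv σ s = 0 := fun s hs => by
    have : σ =ᶠ[𝓝 s] fun _ => 0 := by
      filter_upwards [Iio_mem_nhds hs] with t ht using h0 t (le_of_lt ht)
    rw [this.deriv_eq]
    simp
  have d1 : ∀ s, 1 < s → deriv σ s = 1 := fun s hs => by
    have : σ =ᶠ[𝓝 s] fun t => t := by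
      filter_upwards [Ioi_mem_nhds hs] with t ht using h1 t (le_of_lt ht)
    rw [this.deriv_eq]
    simp
  refine ⟨σ, hσ, h0, fun s => ?_, ?_, d0, d1⟩
  · rcases le_total s 0 with h | h
    · simp [h0 s h, h]
    rcases le_total 1 s with h' | h'
    · simp [h1 s h', h]
    · rw [max_eq_left h, abs_le]
      have a := Real.smoothTransition.nonneg s
      have b := Real.smoothTransition.le_one s
      constructor <;> simp only [σ] <;> nlinarith
  · obtain ⟨C, hC⟩ := (isCompact_Icc (a := (0 : ℝ)) (b := 1)).exists_bound_of_continuousOn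
      (hσ.continuous_deriv (by simp)).continuousOn
    refine ⟨max C 1, fun s => ?_⟩
    rcases lt_or_ge s 0 with h | h
    · simp [d0 s h]
    rcases lt_or_ge 1 s with h' | h'
    · simp [d1 s h']
    · exact (hC s ⟨h, h'⟩).trans (le_max_left _ _)

/-- Smooth approximations of the truncation `t ↦ (t - M)₊ - (m - t)₊`. -/
theorem exists_smooth_truncation {m M : ℝ} (hm : m < M) : ∃ T : ℕ → ℝ → ℝ,
    (∀ k, ContDiff ℝ (⊤ : ℕ∞) (T k)) ∧ (∀ k, ∀ t ∈ Icc m M, T k t = 0) ∧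
    (∀ k t, |T k t - (max (t - M) 0 - max (m - t) 0)| ≤ 2 * (1 / ((k : ℝ) + 1))) ∧
    (∃ C, ∀ k t, |deriv (T k) t| ≤ C) ∧
    ∀ t, t ≠ m → t ≠ M → ∀ s : ℕ → ℝ, Tendsto s atTop (𝓝 t) →
      ∀ᶠ k in atTop, deriv (T k) (s k) = (Iio m ∪ Ioi M).indicator (fun _ => 1) t := by
  obtain ⟨σ, hσ, h0, hmax, ⟨C, hC⟩, d0, d1⟩ := exists_smooth_ramp
  let δ : ℕ → ℝ := fun k => 1 / ((k : ℝ) + 1)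
  have hδ : ∀ k, 0 < δ k := fun k => by positivity
  have hδ0 : Tendsto δ atTop (𝓝 0) := tendsto_one_div_add_atTop_nhds_zero_nat
  let T : ℕ → ℝ → ℝ := fun k t => δ k * σ ((t - M) / δ k) - δ k * σ ((m - t) / δ k)
  have hdσ : Differentiable ℝ σ := hσ.differentiable (by simp)
  have hder : ∀ k t, deriv (T k) t = deriv σ ((t - M) / δ k) + deriv σ ((m - t) / δ k) := by
    intro k t
    have a1 : HasDerivAt (fun t => (t - M) / δ k) (1 / δ k) t :=
      ((hasDerivAt_id t).sub_const M).div_const _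
    have a2 : HasDerivAt (fun t => (m - t) / δ k) (-1 / δ k) t :=
      ((hasDerivAt_id t).const_sub m).div_const _
    have b1 := ((hdσ _).hasDerivAt.comp t a1).const_mul (δ k)
    have b2 := ((hdσ _).hasDerivAt.comp t a2).const_mul (δ k)
    have := (b1.sub b2).deriv
    have e : deriv (T k) t = _ := this
    rw [e]
    have := (hδ k).ne'
    field_simp
    ring
  refine ⟨T, fun k => ?_, fun k t ht => ?_, fun k t => ?_, ⟨C + C, fun k t => ?_⟩, ?_⟩
  · have a1 : ContDiff ℝ (⊤ : ℕ∞) fun t : ℝ => (t - M) / δ k :=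
      (contDiff_id.sub contDiff_const).div_const _
    have a2 : ContDiff ℝ (⊤ : ℕ∞) fun t : ℝ => (m - t) / δ k :=
      (contDiff_const.sub contDiff_id).div_const _
    exact (contDiff_const.mul (hσ.comp a1)).sub (contDiff_const.mul (hσ.comp a2))
  · simp only [T]
    rw [h0 _ (div_nonpos_of_nonpos_of_nonneg (by linarith [ht.2]) (hδ k).le),
      h0 _ (div_nonpos_of_nonpos_of_nonneg (by linarith [ht.1]) (hδ k).le)]
    simp
  · have e : ∀ s, |δ k * σ (s / δ k) - max s 0| ≤ δ k := by
      intro s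
      have e1 : max s 0 = δ k * max (s / δ k) 0 := by
        rw [mul_max_of_nonneg _ _ (hδ k).le, mul_div_cancel₀ _ (hδ k).ne', mul_zero]
      rw [e1, ← mul_sub, abs_mul, abs_of_pos (hδ k)]
      exact mul_le_of_le_one_right (hδ k).le (hmax _)
    have e1 := abs_le.1 (e (t - M))
    have e2 := abs_le.1 (e (m - t))
    simp only [T]
    change _ ≤ 2 * δ k
    rw [abs_le]
    constructor <;> linarith [e1.1, e1.2, e2.1, e2.2]
  · rw [hder]
    exact (abs_add_le _ _).trans (add_le_add (hC _) (hC _))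
  · intro t htm htM s hs
    have neg : ∀ (a : ℕ → ℝ) (l : ℝ), l < 0 → Tendsto a atTop (𝓝 l) →
        ∀ᶠ k in atTop, deriv σ (a k / δ k) = 0 := fun a l hl ha => by
      filter_upwards [ha.eventually_lt_const hl] with k hk
      exact d0 _ (div_neg_of_neg_of_pos hk (hδ k))
    have pos : ∀ (a : ℕ → ℝ) (l : ℝ), 0 < l → Tendsto a atTop (𝓝 l) →
        ∀ᶠ k in atTop, deriv σ (a k / δ k) = 1 := fun a l hl ha => by
      have := ha.sub hδ0
      rw [sub_zero] at this
      filter_upwards [this.eventually_const_lt hl] with k hk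
      exact d1 _ ((one_lt_div (hδ k)).2 (by linarith))
    simp_rw [hder]
    have l1 : Tendsto (fun k => s k - M) atTop (𝓝 (t - M)) := hs.sub_const M
    have l2 : Tendsto (fun k => m - s k) atTop (𝓝 (m - t)) := hs.const_sub m
    rcases lt_trichotomy t m with h | h | h
    · filter_upwards [neg _ _ (by linarith) l1, pos _ _ (by linarith) l2] with k e1 e2
      rw [e1, e2, indicator_of_mem (mem_union_left _ (mem_Iio.2 h)), zero_add]
    · exact absurd h htm
    rcases lt_trichotomy t M with h' | h' | h'
    · filter_upwards [neg _ _ (by linarith) l1, neg _ _ (by linarith) l2] with k e1 e2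
      rw [e1, e2, indicator_of_notMem, zero_add]
      rintro (h3 | h3)
      · exact lt_asymm h h3
      · exact lt_asymm h' h3
    · exact absurd h' htM
    · filter_upwards [pos _ _ (by linarith) l1, neg _ _ (by linarith) l2] with k e1 e2
      rw [e1, e2, indicator_of_mem (mem_union_right _ (mem_Ioi.2 h')), add_zero]

theorem WeaklyMonotone.ae_mem_Icc_of_frontier_aux {n : ℕ} {Ω Q : Set (Euc n)} {u : Euc n → ℝ}
    (hmon : WeaklyMonotone Ω u) (hQ : IsOpen Q) (hQc : IsCompact (closure Q))
    (hQΩ : closure Q ⊆ Ω) {G : Euc n → Euc n} (hu : IntegrableOn u Q) (hG : IntegrableOn G Q)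
    {w : ℕ → Euc n → ℝ} (hw : ∀ k, ContDiff ℝ (⊤ : ℕ∞) (w k))
    (hlim : Tendsto (fun k => ∫⁻ x in Q, ‖w k x - u x‖ₑ) atTop (𝓝 0))
    (hlim' : Tendsto (fun k => ∫⁻ x in Q, ‖gradient (w k) x - G x‖ₑ) atTop (𝓝 0))
    (hae : ∀ᵐ x ∂volume.restrict Q, Tendsto (fun k => w k x) atTop (𝓝 (u x)))
    {m M : ℝ} (hmM : m < M) (hm : ∀ᵐ x ∂volume.restrict Q, u x ≠ m)
    (hM : ∀ᵐ x ∂volume.restrict Q, u x ≠ M)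
    (hf : ∀ k, ∀ z ∈ frontier Q, w k z ∈ Ioo m M) :
    ∀ᵐ x ∂volume.restrict Q, m ≤ u x ∧ u x ≤ M := by
  obtain ⟨T, hT, hT0, hTd, ⟨C, hTC⟩, hTlim⟩ := exists_smooth_truncation hmM
  refine hmon Q hQ hQc hQΩ m M hmM.le ?_
  set χ : ℝ → ℝ := (Iio m ∪ Ioi M).indicator (fun _ => 1) with hχ
  have hχm : Measurable χ := measurable_const.indicator (measurableSet_Iio.union measurableSet_Ioi)
  have hχ1 : ∀ t, ‖χ t‖ ≤ 1 := fun t => by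
    by_cases h : t ∈ Iio m ∪ Ioi M
    · simp [hχ, indicator_of_mem h]
    · simp [hχ, indicator_of_notMem h]
  have hC0 : 0 ≤ C := (abs_nonneg _).trans (hTC 0 0)
  have hvol : volume Q < ∞ := (measure_mono subset_closure).trans_lt hQc.measure_lt_top
  have hfin : IsFiniteMeasure (volume.restrict Q) := ⟨by simpa using hvol⟩
  let τ : ℝ → ℝ := fun t => max (t - M) 0 - max (m - t) 0
  have hτ : Continuous τ := by fun_prop
  have hτl : ∀ s t, |τ s - τ t| ≤ 2 * |s - t| := by
    intro s t
    have e1 := abs_max_sub_max_le_abs (s - M) (t - M) 0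
    have e2 := abs_max_sub_max_le_abs (m - s) (m - t) 0
    rw [show s - M - (t - M) = s - t by ring] at e1
    rw [show m - s - (m - t) = -(s - t) by ring, abs_neg] at e2
    have e3 := abs_sub (max (s - M) 0 - max (t - M) 0) (max (m - s) 0 - max (m - t) 0)
    calc |τ s - τ t| = |(max (s - M) 0 - max (t - M) 0) - (max (m - s) 0 - max (m - t) 0)| := by
          simp only [τ]; ring_nf
      _ ≤ _ := e3
      _ ≤ _ := by linarith
  have hv : IntegrableOn (fun x => τ (u x)) Q := by
    have hb : Integrable (fun x => 2 * |u x - m| + |τ m|) (volume.restrict Q) :=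
      ((hu.sub (integrable_const m)).abs.const_mul 2).add (integrable_const _)
    refine hb.mono' (hτ.comp_aestronglyMeasurable hu.aestronglyMeasurable) (ae_of_all _ fun x => ?_)
    have := hτl (u x) m
    have h2 := abs_sub_abs_le_abs_sub (τ (u x)) (τ m)
    rw [Real.norm_eq_abs]
    linarith
  have hχu : AEStronglyMeasurable (fun x => χ (u x)) (volume.restrict Q) :=
    (hχm.comp_aemeasurable hu.aestronglyMeasurable.aemeasurable).aestronglyMeasurable
  have hh : IntegrableOn (fun x => χ (u x) • G x) Q :=
    hG.bdd_smul 1 hχu (ae_of_all _ fun x => hχ1 _)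
  let φ : ℕ → Euc n → ℝ := fun k => Q.indicator fun x => T k (w k x)
  let K : ℕ → Set (Euc n) := fun k => closure Q ∩ (w k) ⁻¹' (Ioo m M)ᶜ
  have hKcl : ∀ k, IsClosed (K k) := fun k =>
    isClosed_closure.inter (isOpen_Ioo.isClosed_compl.preimage (hw k).continuous)
  have hKc : ∀ k, IsCompact (K k) := fun k => hQc.of_isClosed_subset (hKcl k) inter_subset_left
  have hKQ : ∀ k, K k ⊆ Q := by
    rintro k x ⟨h1, h2⟩
    by_contra hx
    exact h2 (hf k x ⟨h1, by rwa [hQ.interior_eq]⟩)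
  have hsupp : ∀ k, Function.support (φ k) ⊆ K k := by
    intro k x hx
    by_cases hxQ : x ∈ Q
    · refine ⟨subset_closure hxQ, fun h => hx ?_⟩
      simp only [φ, indicator_of_mem hxQ]
      exact hT0 k _ (Ioo_subset_Icc_self h)
    · exact absurd (by simp [φ, hxQ]) hx
  have hts : ∀ k, tsupport (φ k) ⊆ K k := fun k => closure_minimal (hsupp k) (hKcl k)
  have hloc : ∀ k, ∀ x ∈ Q, φ k =ᶠ[𝓝 x] fun x => T k (w k x) := fun k x hx => by
    filter_upwards [hQ.mem_nhds hx] with y hy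
    simp [φ, hy]
  have hφ : ∀ k, ContDiff ℝ (⊤ : ℕ∞) (φ k) := by
    intro k
    rw [contDiff_iff_contDiffAt]
    intro x
    by_cases hx : x ∈ Q
    · exact (((hT k).comp (hw k)).contDiffAt).congr_of_eventuallyEq (hloc k x hx)
    · have : φ k =ᶠ[𝓝 x] fun _ => 0 := by
        filter_upwards [(hKcl k).isOpen_compl.mem_nhds fun h => hx (hKQ k h)] with y hy
        by_contra h0
        exact hy (hsupp k h0)
      exact contDiffAt_const.congr_of_eventuallyEq this
  have hgr : ∀ k, ∀ x ∈ Q, gradient (φ k) x = deriv (T k) (w k x) • gradient (w k) x := by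
    intro k x hx
    have h1 : HasFDerivAt (w k) (fderiv ℝ (w k) x) x :=
      ((hw k).differentiable (by simp) x).hasFDerivAt
    have h2 : HasDerivAt (T k) (deriv (T k) (w k x)) (w k x) :=
      ((hT k).differentiable (by simp) _).hasDerivAt
    have h3 := (h2.comp_hasFDerivAt x h1).fderiv
    have h4 : fderiv ℝ (φ k) x = deriv (T k) (w k x) • fderiv ℝ (w k) x := by
      rw [(hloc k x hx).fderiv_eq]
      exact h3
    simp [gradient, h4]
  refine memW110_of_tendsto hv hh hφ (fun k => (hKc k).of_isClosed_subset isClosed_closure (hts k))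
    (fun k => (hts k).trans (hKQ k)) ?_ ?_
  · have hδ : Tendsto (fun k : ℕ => ENNReal.ofReal (2 * (1 / ((k : ℝ) + 1))) * volume Q)
        atTop (𝓝 0) := by
      have h1 : Tendsto (fun k : ℕ => 2 * (1 / ((k : ℝ) + 1))) atTop (𝓝 0) := by
        simpa using tendsto_one_div_add_atTop_nhds_zero_nat.const_mul (2 : ℝ)
      have h2 := ENNReal.tendsto_ofReal h1
      rw [ENNReal.ofReal_zero] at h2
      simpa using ENNReal.Tendsto.mul_const h2 (Or.inr hvol.ne)
    have h2 := hδ.add (ENNReal.Tendsto.const_mul (a := 2) hlim (Or.inr (by simp)))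
    rw [mul_zero, add_zero] at h2
    refine tendsto_of_tendsto_of_tendsto_of_le_of_le tendsto_const_nhds h2 (fun _ => zero_le)
      fun k => ?_
    show _ ≤ _ + 2 * ∫⁻ x in Q, ‖w k x - u x‖ₑ
    rw [← lintegral_const_mul' _ _ (by simp), ← setLIntegral_const,
      ← lintegral_add_left measurable_const]
    refine setLIntegral_mono' hQ.measurableSet fun x hx => ?_
    have e1 : |φ k x - τ (u x)| ≤ 2 * (1 / ((k : ℝ) + 1)) + 2 * |w k x - u x| := by
      have e2 : φ k x = T k (w k x) := by simp [φ, hx]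
      rw [e2]
      have e3 : |T k (w k x) - τ (w k x)| ≤ 2 * (1 / ((k : ℝ) + 1)) := hTd k (w k x)
      exact (abs_sub_le _ (τ (w k x)) _).trans (add_le_add e3 (hτl _ _))
    rw [← ofReal_norm, ← ofReal_norm, Real.norm_eq_abs, Real.norm_eq_abs,
      show (2 : ℝ≥0∞) = ENNReal.ofReal 2 by simp, ← ENNReal.ofReal_mul (by norm_num),
      ← ENNReal.ofReal_add (by positivity) (by positivity)]
    exact ENNReal.ofReal_le_ofReal e1
  · have hdct : Tendsto (fun k => ∫⁻ x in Q, ‖(deriv (T k) (w k x) - χ (u x)) • G x‖ₑ)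
        atTop (𝓝 0) := by
      have hbound : ∫⁻ x in Q, ENNReal.ofReal (C + 1) * ‖G x‖ₑ ≠ ∞ := by
        rw [lintegral_const_mul' _ _ ENNReal.ofReal_ne_top]
        exact ENNReal.mul_ne_top ENNReal.ofReal_ne_top hG.2.ne
      have := tendsto_lintegral_of_dominated_convergence'
        (F := fun k x => ‖(deriv (T k) (w k x) - χ (u x)) • G x‖ₑ) (f := fun _ => 0)
        (μ := volume.restrict Q)
        (fun x => ENNReal.ofReal (C + 1) * ‖G x‖ₑ) (fun k => ?_) (fun k => ?_) hbound ?_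
      · simpa using this
      · have hcd : Continuous fun x => deriv (T k) (w k x) :=
          ((hT k).continuous_deriv (by simp)).comp (hw k).continuous
        exact ((hcd.aestronglyMeasurable.sub hχu).smul hG.aestronglyMeasurable).enorm
      · refine ae_of_all _ fun x => ?_
        beta_reduce
        rw [enorm_smul]
        gcongr
        rw [← ofReal_norm]
        refine ENNReal.ofReal_le_ofReal ((norm_sub_le _ _).trans (add_le_add (hTC _ _) (hχ1 _)))
      · filter_upwards [hae, hm, hM] with x h1 h2 h3
        refine tendsto_const_nhds.congr' ?_
        filter_upwards [hTlim (u x) h2 h3 _ h1] with k hk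
        rw [hk]
        simp [hχ]
    have h2 := (ENNReal.Tendsto.const_mul (a := ENNReal.ofReal C) hlim'
      (Or.inr (by simp))).add hdct
    rw [mul_zero, add_zero] at h2
    refine tendsto_of_tendsto_of_tendsto_of_le_of_le tendsto_const_nhds h2 (fun _ => zero_le)
      fun k => ?_
    show _ ≤ ENNReal.ofReal C * (∫⁻ x in Q, ‖gradient (w k) x - G x‖ₑ) + _
    have hgc : Continuous (gradient (w k)) :=
      (InnerProductSpace.toDual ℝ (Euc n)).symm.continuous.comp
        ((hw k).continuous_fderiv (by simp))
    rw [← lintegral_const_mul' _ _ (by simp), ← lintegral_add_left']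
    · refine setLIntegral_mono' hQ.measurableSet fun x hx => ?_
      have e : gradient (φ k) x - χ (u x) • G x =
          deriv (T k) (w k x) • (gradient (w k) x - G x) +
            (deriv (T k) (w k x) - χ (u x)) • G x := by
        rw [hgr k x hx, smul_sub, sub_smul]
        abel
      rw [e]
      refine (enorm_add_le _ _).trans ?_
      gcongr
      rw [enorm_smul]
      gcongr
      rw [← ofReal_norm]
      exact ENNReal.ofReal_le_ofReal (hTC _ _)
    · exact ((hgc.aestronglyMeasurable.sub hG.aestronglyMeasurable).enorm).const_mul _

theorem WeaklyMonotone.ae_mem_Icc_of_frontier {n : ℕ} {Ω Q : Set (Euc n)} {u : Euc n → ℝ}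
    (hmon : WeaklyMonotone Ω u) (hQ : IsOpen Q) (hQc : IsCompact (closure Q))
    (hQΩ : closure Q ⊆ Ω) {G : Euc n → Euc n} (hu : IntegrableOn u Q) (hG : IntegrableOn G Q)
    {w : ℕ → Euc n → ℝ} (hw : ∀ k, ContDiff ℝ (⊤ : ℕ∞) (w k))
    (hlim : Tendsto (fun k => ∫⁻ x in Q, ‖w k x - u x‖ₑ) atTop (𝓝 0))
    (hlim' : Tendsto (fun k => ∫⁻ x in Q, ‖gradient (w k) x - G x‖ₑ) atTop (𝓝 0))
    {m M : ℝ} (hmM : m ≤ M) (hf : ∃ᶠ k in atTop, ∀ z ∈ frontier Q, w k z ∈ Icc m M) :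
    ∀ᵐ x ∂volume.restrict Q, m ≤ u x ∧ u x ≤ M := by
  obtain ⟨κ, hκ, hfκ⟩ := extraction_of_frequently_atTop hf
  have hmeas : TendstoInMeasure (volume.restrict Q) (fun k => w (κ k)) atTop u := by
    refine tendstoInMeasure_of_tendsto_eLpNorm one_ne_zero
      (fun k => (hw _).continuous.aestronglyMeasurable) hu.aestronglyMeasurable ?_
    simp only [eLpNorm_one_eq_lintegral_enorm, Pi.sub_apply]
    exact hlim.comp hκ.tendsto_atTop
  obtain ⟨ι, hι, hae⟩ := hmeas.exists_seq_tendsto_ae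
  have hlt : Tendsto (fun j => κ (ι j)) atTop atTop := hκ.tendsto_atTop.comp hι.tendsto_atTop
  have hcount : {t : ℝ | 0 < volume.restrict Q {x | u x = t}}.Countable :=
    Measure.countable_meas_level_set_pos₀ hu.aestronglyMeasurable.aemeasurable.nullMeasurable
  have hgen : ∀ a b : ℝ, a < b → ∃ t ∈ Ioo a b, ∀ᵐ x ∂volume.restrict Q, u x ≠ t := by
    intro a b hab
    obtain ⟨t, ht, hnot⟩ : ∃ t ∈ Ioo a b, t ∉ {t : ℝ | 0 < volume.restrict Q {x | u x = t}} := by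
      by_contra hcon
      push Not at hcon
      exact (Cardinal.Real.Ioo_countable_iff.not.2 (not_le.2 hab)) (hcount.mono hcon)
    refine ⟨t, ht, ?_⟩
    have : volume.restrict Q {x | u x = t} = 0 := by simpa using hnot
    rw [ae_iff]
    simpa using this
  have key : ∀ j : ℕ, ∀ᵐ x ∂volume.restrict Q,
      m - 1 / ((j : ℝ) + 1) ≤ u x ∧ u x ≤ M + 1 / ((j : ℝ) + 1) := by
    intro j
    have hj : 0 < 1 / ((j : ℝ) + 1) := by positivity
    obtain ⟨m', hm', hmu⟩ := hgen (m - 1 / ((j : ℝ) + 1)) m (by linarith)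
    obtain ⟨M', hM', hMu⟩ := hgen M (M + 1 / ((j : ℝ) + 1)) (by linarith)
    have := hmon.ae_mem_Icc_of_frontier_aux hQ hQc hQΩ hu hG (fun j => hw (κ (ι j)))
      (hlim.comp hlt) (hlim'.comp hlt) hae (by linarith [hm'.2, hM'.1]) hmu hMu
      (fun j z hz => ⟨hm'.2.trans_le (hfκ _ z hz).1, (hfκ _ z hz).2.trans_lt hM'.1⟩)
    filter_upwards [this] with x hx
    exact ⟨hm'.1.le.trans hx.1, hx.2.trans hM'.2.le⟩
  filter_upwards [ae_all_iff.2 key] with x hx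
  have h0 := tendsto_one_div_add_atTop_nhds_zero_nat (𝕜 := ℝ)
  refine ⟨?_, ?_⟩
  · have := h0.const_sub m
    rw [sub_zero] at this
    exact le_of_tendsto' this fun j => (hx j).1
  · have := h0.const_add M
    rw [add_zero] at this
    exact ge_of_tendsto' this fun j => (hx j).2

theorem lintegral_comp_smul_pi {d : ℕ} {F : (Fin d → ℝ) → ℝ≥0∞} (hF : Measurable F) {t : ℝ}
    (ht : 0 < t) : ∫⁻ v, F (t • v) = ENNReal.ofReal ((t ^ d)⁻¹) * ∫⁻ z, F z := by
  rw [← lintegral_map hF (measurable_const_smul t), Measure.map_addHaar_smul volume ht.ne',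
    lintegral_smul_measure, abs_of_nonneg (by positivity)]
  simp

theorem enorm_le_enorm_add_lintegral_of_fderiv_le {E : Type*} [NormedAddCommGroup E]
    [NormedSpace ℝ E] {w : E → ℝ} (hw : ContDiff ℝ 1 w) {a : E → ℝ} {C : ℝ} (hC : 0 ≤ C)
    (h : ∀ z, ‖fderiv ℝ w z‖ ≤ C * a z) {R : ℝ} (hR : 0 ≤ R) (x : E) {v : E} (hv : ‖v‖ ≤ R) :
    ‖w x‖ₑ ≤ ‖w (x + v)‖ₑ +
      ENNReal.ofReal (R * C) * ∫⁻ t in Ioo (0 : ℝ) 1, ENNReal.ofReal (a (x + t • v)) := by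
  have hd : ∀ t : ℝ, HasDerivAt (fun t : ℝ => w (x + t • v)) (fderiv ℝ w (x + t • v) v) t := by
    intro t
    have h1 : HasDerivAt (fun t : ℝ => x + t • v) v t := by
      simpa using ((hasDerivAt_id t).smul_const v).const_add x
    exact ((hw.differentiable (by simp) _).hasFDerivAt).comp_hasDerivAt t h1
  have hc : Continuous fun t : ℝ => fderiv ℝ w (x + t • v) v :=
    ((hw.continuous_fderiv (by simp)).comp (by fun_prop)).clm_apply continuous_const
  have hftc := intervalIntegral.integral_eq_sub_of_hasDerivAt (a := 0) (b := 1)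
    (fun t _ => hd t) (hc.intervalIntegrable _ _)
  simp only [one_smul, zero_smul, add_zero] at hftc
  have e1 : ‖w (x + v) - w x‖ₑ ≤
      ENNReal.ofReal (R * C) * ∫⁻ t in Ioo (0 : ℝ) 1, ENNReal.ofReal (a (x + t • v)) := by
    rw [← hftc, intervalIntegral.integral_of_le zero_le_one, integral_Ioc_eq_integral_Ioo,
      ← lintegral_const_mul' _ _ ENNReal.ofReal_ne_top]
    refine (enorm_integral_le_lintegral_enorm _).trans (lintegral_mono fun t => ?_)
    rw [← ENNReal.ofReal_mul (by positivity), ← ofReal_norm]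
    refine ENNReal.ofReal_le_ofReal ?_
    calc ‖fderiv ℝ w (x + t • v) v‖ ≤ ‖fderiv ℝ w (x + t • v)‖ * ‖v‖ :=
          ContinuousLinearMap.le_opNorm _ _
      _ ≤ C * a (x + t • v) * R := by
          have := h (x + t • v)
          have h0 := (norm_nonneg _).trans this
          gcongr
      _ = _ := by ring
  calc ‖w x‖ₑ = ‖w (x + v) - (w (x + v) - w x)‖ₑ := by congr 1; ring
    _ ≤ ‖w (x + v)‖ₑ + ‖w (x + v) - w x‖ₑ := enorm_sub_le
    _ ≤ _ := by gcongr

theorem lintegral_dyadic_inv_le_one {s : ℝ} (hs : 0 ≤ s) :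
    ∫⁻ t in Ioo (0 : ℝ) 1, (Icc (s / 2) s).indicator (fun t => ENNReal.ofReal t⁻¹) t ≤ 1 := by
  rcases hs.eq_or_lt with rfl | hs
  · refine le_of_eq_of_le (setLIntegral_congr_fun measurableSet_Ioo (g := fun _ => 0)
      fun t ht => ?_) (by simp)
    rw [indicator_of_notMem]
    intro h
    linarith [ht.1, h.2]
  calc _ ≤ ∫⁻ t, (Icc (s / 2) s).indicator (fun t => ENNReal.ofReal t⁻¹) t :=
        setLIntegral_le_lintegral _ _
    _ = ∫⁻ t in Icc (s / 2) s, ENNReal.ofReal t⁻¹ := lintegral_indicator measurableSet_Icc _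
    _ ≤ ∫⁻ _ in Icc (s / 2) s, ENNReal.ofReal (s / 2)⁻¹ := by
        refine setLIntegral_mono' measurableSet_Icc fun t ht => ENNReal.ofReal_le_ofReal ?_
        exact inv_anti₀ (half_pos hs) ht.1
    _ = 1 := by
        rw [setLIntegral_const, Real.volume_Icc, ← ENNReal.ofReal_mul (by positivity),
          show s - s / 2 = s / 2 by ring, inv_mul_cancel₀ (half_pos hs).ne', ENNReal.ofReal_one]

theorem GrowthFn.exists_abs_le {e : ℕ} {Φ : ℝ → ℝ} (hΦ : GrowthFn e Φ) {C : ℝ} (hC : 0 ≤ C) :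
    ∃ C₀ : ℝ, 0 ≤ C₀ ∧ ∀ (w a : (Fin (e + 1) → ℝ) → ℝ), ContDiff ℝ 1 w → Continuous a →
      (∀ z, 0 ≤ a z) → (∀ z, ‖fderiv ℝ w z‖ ≤ C * a z) → ∀ x,
      ∫⁻ z in closedBall x 2, (‖w z‖ₑ + ENNReal.ofReal (Φ (a z))) ≤ 1 → |w x| ≤ C₀ := by
  obtain ⟨c, b, hb, hbI, hker⟩ := hΦ.kernel
  let V : Set (Fin (e + 1) → ℝ) := {v | 1 ≤ ‖v‖ ∧ ‖v‖ ≤ 2}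
  have hVcl : IsClosed V :=
    (isClosed_le continuous_const continuous_norm).inter (isClosed_le continuous_norm continuous_const)
  have hVm : MeasurableSet V := hVcl.measurableSet
  have hVsub : V ⊆ closedBall 0 2 := fun v hv => by simpa using hv.2
  have hVfin : volume V < ∞ := (measure_mono hVsub).trans_lt measure_closedBall_lt_top
  have hVpos : volume V ≠ 0 := by
    have hsub : ball (fun _ : Fin (e + 1) => (3 / 2 : ℝ)) (1 / 2) ⊆ V := by
      intro v hv
      have h1 : ‖(fun _ : Fin (e + 1) => (3 / 2 : ℝ))‖ = 3 / 2 := by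
        rw [pi_norm_const]; norm_num
      have h2 : ‖v - fun _ => 3 / 2‖ < 1 / 2 := by rwa [← dist_eq_norm]
      have h3 := abs_le.1 (abs_norm_sub_norm_le v (fun _ : Fin (e + 1) => (3 / 2 : ℝ)))
      rw [h1] at h3
      constructor <;> linarith [h3.1, h3.2]
    exact ((measure_ball_pos volume _ (by norm_num)).trans_le (measure_mono hsub)).ne'
  set Bd : ℝ≥0∞ := (1 + ENNReal.ofReal (2 * C) * (c * 1 + (∫⁻ t in Ioo 0 1, b t) * volume V)) /
    volume V with hBd
  have hBfin : Bd ≠ ∞ := by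
    refine ENNReal.div_ne_top ?_ hVpos
    refine ENNReal.add_ne_top.2 ⟨by simp, ENNReal.mul_ne_top ENNReal.ofReal_ne_top ?_⟩
    exact ENNReal.add_ne_top.2 ⟨by simp, ENNReal.mul_ne_top hbI.ne hVfin.ne⟩
  refine ⟨Bd.toReal, ENNReal.toReal_nonneg, fun w a hw ha ha0 hwa x hI => ?_⟩
  suffices hmain : ‖w x‖ₑ ≤ Bd by
    have := ENNReal.toReal_mono hBfin hmain
    rwa [toReal_enorm, Real.norm_eq_abs] at this
  rw [hBd, ENNReal.le_div_iff_mul_le (Or.inl hVpos) (Or.inl hVfin.ne)]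
  let f : (Fin (e + 1) → ℝ) → ℝ≥0∞ := fun z => ENNReal.ofReal (Φ (a z))
  have hf : Measurable f := (hΦ.continuous.comp ha).measurable.ennreal_ofReal
  have hwm : Measurable fun z => ‖w z‖ₑ := hw.continuous.measurable.enorm
  rw [lintegral_add_left hwm] at hI
  have hW : ∫⁻ z in closedBall x 2, ‖w z‖ₑ ≤ 1 := le_self_add.trans hI
  have hFI : ∫⁻ z in closedBall x 2, f z ≤ 1 := le_add_self.trans hI
  have hpt : ∀ v ∈ V, ‖w x‖ₑ ≤ ‖w (x + v)‖ₑ + ENNReal.ofReal (2 * C) *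
      (c * (∫⁻ t in Ioo (0 : ℝ) 1, ENNReal.ofReal (t ^ e) * f (x + t • v)) +
        ∫⁻ t in Ioo 0 1, b t) := by
    intro v hv
    refine (enorm_le_enorm_add_lintegral_of_fderiv_le hw hC hwa zero_le_two x hv.2).trans ?_
    gcongr
    rw [← lintegral_const_mul' _ _ ENNReal.coe_ne_top, ← lintegral_add_right _ hb]
    refine setLIntegral_mono' measurableSet_Ioo fun t ht => ?_
    rw [← ENNReal.ofReal_mul (pow_nonneg ht.1.le _)]
    exact hker _ (ha0 _) t ht
  have htrans : ∀ g : (Fin (e + 1) → ℝ) → ℝ≥0∞,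
      ∫⁻ v in closedBall 0 2, g (x + v) = ∫⁻ z in closedBall x 2, g z := by
    intro g
    rw [← lintegral_indicator isClosed_closedBall.measurableSet,
      ← lintegral_indicator isClosed_closedBall.measurableSet,
      ← lintegral_add_left_eq_self ((closedBall x 2).indicator g) x]
    refine lintegral_congr fun v => ?_
    by_cases hv : v ∈ closedBall (0 : Fin (e + 1) → ℝ) 2
    · rw [indicator_of_mem hv, indicator_of_mem (by simpa using hv)]
    · rw [indicator_of_notMem hv, indicator_of_notMem (by simpa using hv)]
  have hdouble : ∫⁻ v in V, ∫⁻ t in Ioo (0 : ℝ) 1, ENNReal.ofReal (t ^ e) * f (x + t • v) ≤ 1 := by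
    let J : (Fin (e + 1) → ℝ) → ℝ → ℝ≥0∞ := fun z t =>
      (Icc (‖z‖ / 2) ‖z‖).indicator (fun t => ENNReal.ofReal t⁻¹) t * (closedBall 0 2).indicator (fun z => f (x + z)) z
    have hset : MeasurableSet {p : (Fin (e + 1) → ℝ) × ℝ | p.2 ∈ Icc (‖p.1‖ / 2) ‖p.1‖} := by
      show MeasurableSet ({p : (Fin (e + 1) → ℝ) × ℝ | ‖p.1‖ / 2 ≤ p.2} ∩ {p | p.2 ≤ ‖p.1‖})
      exact (measurableSet_le (by fun_prop) (by fun_prop)).inter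
        (measurableSet_le (by fun_prop) (by fun_prop))
    have hfx : Measurable fun z => f (x + z) := hf.comp (measurable_const_add x)
    have hJ : Measurable (Function.uncurry J) := by
      have h1 : Measurable fun p : (Fin (e + 1) → ℝ) × ℝ =>
          {p : (Fin (e + 1) → ℝ) × ℝ | p.2 ∈ Icc (‖p.1‖ / 2) ‖p.1‖}.indicator
            (fun p => ENNReal.ofReal p.2⁻¹) p :=
        (measurable_snd.inv.ennreal_ofReal).indicator hset
      have h2 : Measurable fun p : (Fin (e + 1) → ℝ) × ℝ =>
          (closedBall 0 2).indicator (fun z => f (x + z)) p.1 :=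
        (hfx.indicator isClosed_closedBall.measurableSet).comp measurable_fst
      exact h1.mul h2
    have hslice : ∀ t ∈ Ioo (0 : ℝ) 1,
        ∫⁻ v in V, ENNReal.ofReal (t ^ e) * f (x + t • v) = ∫⁻ z, J z t := by
      intro t ht
      have ht0 := ht.1
      let Vt : Set (Fin (e + 1) → ℝ) := {z | t ≤ ‖z‖ ∧ ‖z‖ ≤ 2 * t}
      have hVt : MeasurableSet Vt :=
        ((isClosed_le continuous_const continuous_norm).inter
          (isClosed_le continuous_norm continuous_const)).measurableSet
      have hiff : ∀ v, t • v ∈ Vt ↔ v ∈ V := by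
        intro v
        show (t ≤ ‖t • v‖ ∧ ‖t • v‖ ≤ 2 * t) ↔ (1 ≤ ‖v‖ ∧ ‖v‖ ≤ 2)
        rw [norm_smul, Real.norm_of_nonneg ht0.le, le_mul_iff_one_le_right ht0, mul_comm 2 t,
          mul_le_mul_iff_right₀ ht0]
      have hcv := lintegral_comp_smul_pi (hfx.indicator hVt) ht0
      have e1 : ∫⁻ v, Vt.indicator (fun z => f (x + z)) (t • v) = ∫⁻ v in V, f (x + t • v) := by
        rw [← lintegral_indicator hVm]
        refine lintegral_congr fun v => ?_
        by_cases hv : v ∈ V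
        · rw [indicator_of_mem hv, indicator_of_mem ((hiff v).2 hv)]
        · rw [indicator_of_notMem hv, indicator_of_notMem (mt (hiff v).1 hv)]
      rw [lintegral_const_mul' _ _ ENNReal.ofReal_ne_top, ← e1, hcv, ← mul_assoc,
        ← ENNReal.ofReal_mul (by positivity),
        show t ^ e * (t ^ (e + 1))⁻¹ = t⁻¹ by rw [pow_succ]; field_simp,
        ← lintegral_const_mul' _ _ ENNReal.ofReal_ne_top]
      refine lintegral_congr fun z => ?_
      simp only [J]
      by_cases hz : z ∈ Vt
      · have hmem : t ∈ Icc (‖z‖ / 2) ‖z‖ := ⟨by linarith [hz.2], hz.1⟩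
        rw [indicator_of_mem hz, indicator_of_mem hmem, indicator_of_mem]
        rw [mem_closedBall_zero_iff]
        linarith [hz.2, ht.2]
      · rw [indicator_of_notMem hz, indicator_of_notMem (s := Icc _ _), mul_zero, zero_mul]
        rintro ⟨h1, h2⟩
        exact hz ⟨h2, by linarith⟩
    have hm : Measurable (Function.uncurry fun (v : Fin (e + 1) → ℝ) (t : ℝ) =>
        ENNReal.ofReal (t ^ e) * f (x + t • v)) := by
      refine Measurable.mul (by fun_prop) (hf.comp ?_)
      fun_prop
    rw [lintegral_lintegral_swap hm.aemeasurable, setLIntegral_congr_fun measurableSet_Ioo hslice,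
      ← lintegral_lintegral_swap hJ.aemeasurable]
    calc ∫⁻ z, ∫⁻ t in Ioo (0 : ℝ) 1, J z t
        ≤ ∫⁻ z, (closedBall 0 2).indicator (fun z => f (x + z)) z := by
          refine lintegral_mono fun z => ?_
          have hmz : Measurable
              ((Icc (‖z‖ / 2) ‖z‖).indicator (fun t : ℝ => ENNReal.ofReal t⁻¹)) :=
            measurable_inv.ennreal_ofReal.indicator measurableSet_Icc
          simp only [J]
          rw [lintegral_mul_const _ hmz]
          exact mul_le_of_le_one_left' (lintegral_dyadic_inv_le_one (norm_nonneg z))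
      _ = ∫⁻ z in closedBall x 2, f z := by
          rw [lintegral_indicator isClosed_closedBall.measurableSet, htrans f]
      _ ≤ 1 := hFI
  calc ‖w x‖ₑ * volume V = ∫⁻ _ in V, ‖w x‖ₑ := by rw [setLIntegral_const]
    _ ≤ ∫⁻ v in V, (‖w (x + v)‖ₑ + ENNReal.ofReal (2 * C) *
      (c * (∫⁻ t in Ioo (0 : ℝ) 1, ENNReal.ofReal (t ^ e) * f (x + t • v)) +
        ∫⁻ t in Ioo 0 1, b t)) := setLIntegral_mono' hVm hpt
    _ = (∫⁻ v in V, ‖w (x + v)‖ₑ) + ENNReal.ofReal (2 * C) * (c *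
      (∫⁻ v in V, ∫⁻ t in Ioo (0 : ℝ) 1, ENNReal.ofReal (t ^ e) * f (x + t • v)) +
        (∫⁻ t in Ioo 0 1, b t) * volume V) := by
        have hwx : Measurable fun v => ‖w (x + v)‖ₑ := hwm.comp (measurable_const_add x)
        rw [lintegral_add_left hwx, lintegral_const_mul' _ _ ENNReal.ofReal_ne_top,
          lintegral_add_right _ measurable_const, lintegral_const_mul' _ _ ENNReal.coe_ne_top,
          setLIntegral_const]
    _ ≤ 1 + ENNReal.ofReal (2 * C) * (c * 1 + (∫⁻ t in Ioo 0 1, b t) * volume V) := by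
        gcongr
        calc ∫⁻ v in V, ‖w (x + v)‖ₑ ≤ ∫⁻ v in closedBall 0 2, ‖w (x + v)‖ₑ :=
              lintegral_mono_set hVsub
          _ = _ := htrans fun z => ‖w z‖ₑ
          _ ≤ 1 := hW

def insertCoord {e : ℕ} (i : Fin (e + 2)) (t : ℝ) (v : Fin (e + 1) → ℝ) : Euc (e + 2) :=
  WithLp.toLp 2 (i.insertNth t v)

def insertZeroCoord {e : ℕ} (i : Fin (e + 2)) : (Fin (e + 1) → ℝ) →L[ℝ] Euc (e + 2) :=
  LinearMap.toContinuousLinearMap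
    { toFun := fun v => WithLp.toLp 2 (i.insertNth (0 : ℝ) v)
      map_add' := fun v w => by
        ext j
        refine Fin.succAboveCases i ?_ (fun k => ?_) j <;> simp
      map_smul' := fun c v => by
        ext j
        refine Fin.succAboveCases i ?_ (fun k => ?_) j <;> simp }

theorem insertCoord_eq {e : ℕ} (i : Fin (e + 2)) (t : ℝ) (v : Fin (e + 1) → ℝ) :
    insertCoord i t v = insertCoord i t 0 + insertZeroCoord i v := by
  ext j
  refine Fin.succAboveCases i ?_ (fun k => ?_) j <;> simp [insertCoord, insertZeroCoord]

theorem hasFDerivAt_insertCoord {e : ℕ} (i : Fin (e + 2)) (t : ℝ) (v : Fin (e + 1) → ℝ) :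
    HasFDerivAt (insertCoord i t) (insertZeroCoord i) v := by
  have : insertCoord i t = fun v => insertCoord i t 0 + insertZeroCoord i v :=
    funext (insertCoord_eq i t)
  rw [this]
  exact (insertZeroCoord i).hasFDerivAt.const_add _

theorem contDiff_insertCoord {e : ℕ} (i : Fin (e + 2)) (t : ℝ) :
    ContDiff ℝ 1 (insertCoord i t) := by
  have : insertCoord i t = fun v => insertCoord i t 0 + insertZeroCoord i v :=
    funext (insertCoord_eq i t)
  rw [this]
  exact contDiff_const.add (insertZeroCoord i).contDiff

theorem lintegral_eq_lintegral_insertCoord {e : ℕ} (i : Fin (e + 2)) {F : Euc (e + 2) → ℝ≥0∞}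
    (hF : Measurable F) : ∫⁻ z, F z = ∫⁻ t, ∫⁻ v, F (insertCoord i t v) := by
  have h1 := (PiLp.volume_preserving_toLp (Fin (e + 2))).lintegral_comp hF
  have hF' : Measurable fun z : Fin (e + 2) → ℝ => F (WithLp.toLp 2 z) :=
    hF.comp (WithLp.measurable_toLp 2 _)
  have h2 := ((volume_preserving_piFinSuccAbove (fun _ : Fin (e + 2) => ℝ) i).symm).lintegral_comp hF'
  rw [← h1, ← h2, Measure.volume_eq_prod, lintegral_prod]
  · rfl
  · exact (hF'.comp (MeasurableEquiv.measurable _)).aemeasurable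

theorem measurable_uncurry_insertCoord {e : ℕ} (i : Fin (e + 2)) :
    Measurable fun p : ℝ × (Fin (e + 1) → ℝ) => insertCoord i p.1 p.2 :=
  (WithLp.measurable_toLp 2 _).comp
    (MeasurableEquiv.piFinSuccAbove (fun _ : Fin (e + 2) => ℝ) i).symm.measurable

theorem GrowthFn.exists_abs_le_face {e : ℕ} {Φ : ℝ → ℝ} (hΦ : GrowthFn e Φ) :
    ∃ C₀ : ℝ, 0 ≤ C₀ ∧ ∀ w : Euc (e + 2) → ℝ, ContDiff ℝ 1 w →
      ∫⁻ z in {z : Euc (e + 2) | ∀ i, |z i| ≤ 4},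
        (‖w z‖ₑ + ENNReal.ofReal (Φ ‖fderiv ℝ w z‖)) ≤ (4 * (e + 2 : ℕ) : ℝ≥0∞)⁻¹ →
      ∃ bad : Set ℝ, volume bad ≤ 2⁻¹ ∧ ∀ s ∈ Ioo (1 : ℝ) 2, s ∉ bad → ∀ z : Euc (e + 2),
        (∀ i, |z i| ≤ s) → (∃ i, |z i| = s) → |w z| ≤ C₀ := by
  have hC : 0 ≤ ∑ i : Fin (e + 2), ‖insertZeroCoord i‖ := by positivity
  obtain ⟨C₀, hC₀, hface⟩ := hΦ.exists_abs_le hC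
  refine ⟨C₀, hC₀, fun w hw hI => ?_⟩
  let H : Euc (e + 2) → ℝ≥0∞ := fun z => ‖w z‖ₑ + ENNReal.ofReal (Φ ‖fderiv ℝ w z‖)
  have hcf : Continuous (fderiv ℝ w) := hw.continuous_fderiv (by simp)
  have hH : Measurable H := hw.continuous.measurable.enorm.add
    (hΦ.continuous.comp hcf.norm).measurable.ennreal_ofReal
  let Q : Set (Euc (e + 2)) := {z | ∀ i, |z i| ≤ 4}
  have hQ : MeasurableSet Q := by
    have : Q = ⋂ i, {z : Euc (e + 2) | |z i| ≤ 4} := by ext; simp [Q]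
    rw [this]
    exact MeasurableSet.iInter fun i => measurableSet_le (by fun_prop) (by fun_prop)
  let S : Fin (e + 2) → ℝ → ℝ≥0∞ := fun i t => ∫⁻ v in closedBall 0 4, H (insertCoord i t v)
  have hSm : ∀ i, Measurable (S i) := fun i =>
    (hH.comp (measurable_uncurry_insertCoord i)).lintegral_prod_right'
  have hSI : ∀ i, ∫⁻ t in Icc (-4) 4, S i t ≤ (4 * (e + 2 : ℕ) : ℝ≥0∞)⁻¹ := by
    intro i
    refine le_trans (le_of_eq ?_) hI
    rw [← lintegral_indicator hQ, lintegral_eq_lintegral_insertCoord i (hH.indicator hQ),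
      ← lintegral_indicator measurableSet_Icc]
    refine lintegral_congr fun t => ?_
    have hiff : ∀ v, insertCoord i t v ∈ Q ↔ t ∈ Icc (-4 : ℝ) 4 ∧ v ∈ closedBall (0 : Fin (e + 1) → ℝ) 4 := by
      intro v
      rw [mem_closedBall_zero_iff, pi_norm_le_iff_of_nonneg (by norm_num)]
      show (∀ j, _) ↔ _
      rw [Fin.forall_iff_succAbove i]
      simp [insertCoord, abs_le]
    by_cases ht : t ∈ Icc (-4 : ℝ) 4
    · rw [indicator_of_mem ht]
      simp only [S]
      rw [← lintegral_indicator isClosed_closedBall.measurableSet]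
      refine lintegral_congr fun v => ?_
      by_cases hv : v ∈ closedBall (0 : Fin (e + 1) → ℝ) 4
      · rw [indicator_of_mem hv, indicator_of_mem ((hiff v).2 ⟨ht, hv⟩)]
      · rw [indicator_of_notMem hv, indicator_of_notMem fun h => hv ((hiff v).1 h).2]
    · rw [indicator_of_notMem ht]
      symm
      rw [lintegral_eq_zero_iff' (by
        exact ((hH.indicator hQ).comp ((measurable_uncurry_insertCoord i).comp
          measurable_prodMk_left)).aemeasurable)]
      exact Eventually.of_forall fun v => indicator_of_notMem (fun h => ht ((hiff v).1 h).1) _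
  let B : Fin (e + 2) → Set ℝ := fun i => {t | 1 ≤ S i t} ∩ Icc (-4) 4
  have hB : ∀ i, volume (B i) ≤ (4 * (e + 2 : ℕ) : ℝ≥0∞)⁻¹ := by
    intro i
    refine le_trans ?_ (hSI i)
    have := mul_meas_ge_le_lintegral (μ := volume.restrict (Icc (-4) 4)) (hSm i) 1
    rwa [one_mul, Measure.restrict_apply (measurableSet_le measurable_const (hSm i))] at this
  refine ⟨⋃ i, (B i ∪ -B i), ?_, fun s hs hsb z hz => ?_⟩
  · calc volume (⋃ i, (B i ∪ -B i)) ≤ ∑ i, volume (B i ∪ -B i) := measure_iUnion_fintype_le _ _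
      _ ≤ ∑ i : Fin (e + 2), 2 * (4 * (e + 2 : ℕ) : ℝ≥0∞)⁻¹ := by
          refine Finset.sum_le_sum fun i _ => (measure_union_le _ _).trans ?_
          rw [Measure.measure_neg, two_mul]
          exact add_le_add (hB i) (hB i)
      _ = 2⁻¹ := by
          rw [Finset.sum_const, Finset.card_univ, Fintype.card_fin, nsmul_eq_mul]
          rw [← ENNReal.toReal_eq_toReal_iff' (by finiteness) (by simp)]
          simp only [ENNReal.toReal_mul, ENNReal.toReal_inv, ENNReal.toReal_natCast,
            ENNReal.toReal_ofNat]
          push_cast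
          field_simp
          norm_num
  · rintro ⟨i, hi⟩
    have hzi : insertCoord i (z i) (i.removeNth z) = z := by
      ext j
      simp [insertCoord]
    have hS : S i (z i) ≤ 1 := by
      by_contra hcon
      have hmem : z i ∈ B i := ⟨(not_le.1 hcon).le, abs_le.1 ((hz i).trans (by linarith [hs.2]))⟩
      apply hsb
      rw [mem_iUnion]
      refine ⟨i, ?_⟩
      rcases abs_choice (z i) with h | h
      · left; rwa [← hi, h]
      · right; rw [Set.mem_neg, ← hi, h, neg_neg]; exact hmem
    have hsub : closedBall (i.removeNth z : Fin (e + 1) → ℝ) 2 ⊆ closedBall 0 4 := by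
      refine closedBall_subset_closedBall' ?_
      have : ‖(i.removeNth z : Fin (e + 1) → ℝ)‖ ≤ 2 := by
        rw [pi_norm_le_iff_of_nonneg (by norm_num)]
        intro j
        exact (hz _).trans hs.2.le
      rw [dist_zero_right]
      linarith
    have := hface (fun v => w (insertCoord i (z i) v))
      (fun v => ‖fderiv ℝ w (insertCoord i (z i) v)‖)
      (hw.comp (contDiff_insertCoord i _))
      (hcf.comp (contDiff_insertCoord i _).continuous).norm (fun _ => norm_nonneg _)
      (fun v => ?_) (i.removeNth z) ((lintegral_mono_set hsub).trans hS)
    · rwa [hzi] at this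
    · have hd := ((hw.differentiable (by simp) (insertCoord i (z i) v)).hasFDerivAt).comp v
        (hasFDerivAt_insertCoord i (z i) v)
      have : fderiv ℝ (fun v => w (insertCoord i (z i) v)) v = _ := hd.fderiv
      rw [this, mul_comm]
      refine (ContinuousLinearMap.opNorm_comp_le _ _).trans ?_
      gcongr
      exact Finset.single_le_sum (f := fun i => ‖insertZeroCoord i‖)
        (fun _ _ => norm_nonneg _) (Finset.mem_univ i)

/-- The open cube with centre `y` and half-side `s`. -/
def openCube {n : ℕ} (y : Euc n) (s : ℝ) : Set (Euc n) := {z | ∀ i, |z i - y i| < s}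

theorem isOpen_openCube {n : ℕ} (y : Euc n) (s : ℝ) : IsOpen (openCube y s) := by
  have : openCube y s = ⋂ i, {z : Euc n | |z i - y i| < s} := by ext; simp [openCube]
  rw [this]
  exact isOpen_iInter_of_finite fun i => isOpen_lt (by fun_prop) continuous_const

theorem norm_le_of_abs_apply_le {n : ℕ} {z : Euc n} {s : ℝ} (hs : 0 ≤ s) (h : ∀ i, |z i| ≤ s) :
    ‖z‖ ≤ n * s := by
  have h1 : ‖z‖ ^ 2 ≤ (n * s) ^ 2 := by
    rw [EuclideanSpace.norm_sq_eq]
    calc ∑ i, ‖z i‖ ^ 2 ≤ ∑ _i : Fin n, s ^ 2 :=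
          Finset.sum_le_sum fun i _ => by
            rw [Real.norm_eq_abs]
            exact pow_le_pow_left₀ (abs_nonneg _) (h i) 2
      _ = n * s ^ 2 := by simp
      _ ≤ (n * s) ^ 2 := by
          rw [mul_pow]
          gcongr
          exact_mod_cast Nat.le_self_pow two_ne_zero n
  exact le_of_sq_le_sq h1 (by positivity)

theorem closure_openCube_subset {n : ℕ} (y : Euc n) (s : ℝ) :
    closure (openCube y s) ⊆ {z | ∀ i, |z i - y i| ≤ s} := by
  refine closure_minimal (fun z hz i => (hz i).le) ?_
  have : {z : Euc n | ∀ i, |z i - y i| ≤ s} = ⋂ i, {z : Euc n | |z i - y i| ≤ s} := by ext; simp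
  rw [this]
  exact isClosed_iInter fun i => isClosed_le (by fun_prop) continuous_const

theorem abs_apply_sub_le_of_mem_frontier_openCube {n : ℕ} {y : Euc n} {s : ℝ} {z : Euc n}
    (hz : z ∈ frontier (openCube y s)) : (∀ i, |z i - y i| ≤ s) ∧ ∃ i, |z i - y i| = s := by
  rw [(isOpen_openCube y s).frontier_eq] at hz
  have h1 := closure_openCube_subset y s hz.1
  refine ⟨h1, ?_⟩
  by_contra! hcon
  exact hz.2 fun i => lt_of_le_of_ne (h1 i) (hcon i)

theorem closure_openCube_subset_closedBall {n : ℕ} (y : Euc n) {s : ℝ} (hs : 0 ≤ s) :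
    closure (openCube y s) ⊆ closedBall y (n * s) := by
  intro z hz
  rw [mem_closedBall, dist_eq_norm]
  exact norm_le_of_abs_apply_le hs fun i => closure_openCube_subset y s hz i

theorem ball_subset_openCube {n : ℕ} (y : Euc n) (s : ℝ) : ball y s ⊆ openCube y s := by
  intro z hz i
  rw [mem_ball, dist_eq_norm] at hz
  exact (PiLp.norm_apply_le (z - y) i).trans_lt hz

theorem lintegral_comp_smul_euc {n : ℕ} {F : Euc n → ℝ≥0∞} (hF : Measurable F) {t : ℝ}
    (ht : 0 < t) : ∫⁻ v, F (t • v) = ENNReal.ofReal ((t ^ n)⁻¹) * ∫⁻ z, F z := by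
  rw [← lintegral_map hF (measurable_const_smul t), Measure.map_addHaar_smul volume ht.ne',
    lintegral_smul_measure, abs_of_nonneg (by positivity)]
  simp

theorem GrowthFn.exists_abs_le_frontier {e : ℕ} {Φ : ℝ → ℝ} (hΦ : GrowthFn e Φ) :
    ∃ C₀ : ℝ, 0 ≤ C₀ ∧ ∀ w : Euc (e + 2) → ℝ, ContDiff ℝ 1 w → ∀ (y : Euc (e + 2)) (ρ : ℝ), 0 < ρ →
      ∫⁻ z in closedBall y ((e + 2 : ℕ) * (4 * ρ)),
        (ENNReal.ofReal ρ⁻¹ * ‖w z‖ₑ + ENNReal.ofReal (Φ ‖fderiv ℝ w z‖)) ≤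
          ENNReal.ofReal (ρ ^ (e + 2)) * (4 * (e + 2 : ℕ) : ℝ≥0∞)⁻¹ →
      ∃ bad : Set ℝ, volume bad ≤ 2⁻¹ ∧ ∀ s ∈ Ioo (1 : ℝ) 2, s ∉ bad →
        ∀ z ∈ frontier (openCube y (s * ρ)), |w z| ≤ C₀ * ρ := by
  obtain ⟨C₀, hC₀, hface⟩ := hΦ.exists_abs_le_face
  refine ⟨C₀, hC₀, fun w hw y ρ hρ hI => ?_⟩
  let w' : Euc (e + 2) → ℝ := fun z => ρ⁻¹ * w (y + ρ • z)
  have hw' : ContDiff ℝ 1 w' := contDiff_const.mul (hw.comp (by fun_prop))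
  have hcf : Continuous (fderiv ℝ w) := hw.continuous_fderiv (by simp)
  have hfd : ∀ z, fderiv ℝ w' z = fderiv ℝ w (y + ρ • z) := by
    intro z
    have h1 : HasFDerivAt (fun z : Euc (e + 2) => y + ρ • z)
        (ρ • ContinuousLinearMap.id ℝ (Euc (e + 2))) z :=
      ((hasFDerivAt_id z).const_smul ρ).const_add y
    have h2 := (((hw.differentiable (by simp) (y + ρ • z)).hasFDerivAt).comp z h1).const_mul ρ⁻¹
    rw [show fderiv ℝ w' z = _ from h2.fderiv]
    ext v
    simp [hρ.ne']
  let H : Euc (e + 2) → ℝ≥0∞ := fun z =>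
    ENNReal.ofReal ρ⁻¹ * ‖w z‖ₑ + ENNReal.ofReal (Φ ‖fderiv ℝ w z‖)
  have hH : Measurable H := (hw.continuous.measurable.enorm.const_mul _).add
    (hΦ.continuous.comp hcf.norm).measurable.ennreal_ofReal
  have hcb : MeasurableSet (closedBall y (((e + 2 : ℕ) : ℝ) * (4 * ρ))) :=
    isClosed_closedBall.measurableSet
  have hHi := hH.indicator hcb
  obtain ⟨bad, hbad, hgood⟩ := hface w' hw' (by
    calc ∫⁻ z in {z : Euc (e + 2) | ∀ i, |z i| ≤ 4},
          (‖w' z‖ₑ + ENNReal.ofReal (Φ ‖fderiv ℝ w' z‖))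
        = ∫⁻ z in {z : Euc (e + 2) | ∀ i, |z i| ≤ 4}, H (y + ρ • z) := by
          refine lintegral_congr fun z => ?_
          simp only [H, w', hfd, enorm_mul]
          rw [Real.enorm_of_nonneg (by positivity : 0 ≤ ρ⁻¹)]
      _ ≤ ∫⁻ z, (closedBall y (((e + 2 : ℕ) : ℝ) * (4 * ρ))).indicator H (y + ρ • z) := by
          have hQ : MeasurableSet {z : Euc (e + 2) | ∀ i, |z i| ≤ 4} := by
            have : {z : Euc (e + 2) | ∀ i, |z i| ≤ 4} = ⋂ i, {z : Euc (e + 2) | |z i| ≤ 4} := by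
              ext; simp
            rw [this]
            exact MeasurableSet.iInter fun i => measurableSet_le (by fun_prop) (by fun_prop)
          rw [← lintegral_indicator hQ]
          refine lintegral_mono fun z => ?_
          by_cases hz : z ∈ {z : Euc (e + 2) | ∀ i, |z i| ≤ 4}
          · rw [indicator_of_mem hz, indicator_of_mem]
            rw [mem_closedBall, dist_eq_norm, add_sub_cancel_left, norm_smul,
              Real.norm_of_nonneg hρ.le]
            have := norm_le_of_abs_apply_le (by norm_num) hz
            calc ρ * ‖z‖ ≤ ρ * (((e + 2 : ℕ) : ℝ) * 4) := by gcongr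
              _ = _ := by ring
          · rw [indicator_of_notMem hz]; exact zero_le
      _ = ENNReal.ofReal ((ρ ^ (e + 2))⁻¹) *
            ∫⁻ z in closedBall y (((e + 2 : ℕ) : ℝ) * (4 * ρ)), H z := by
          have hcomp := lintegral_comp_smul_euc (hHi.comp (measurable_const_add y)) hρ
          simp only [Function.comp_apply] at hcomp
          rw [hcomp, lintegral_add_left_eq_self, lintegral_indicator hcb]
      _ ≤ ENNReal.ofReal ((ρ ^ (e + 2))⁻¹) *
            (ENNReal.ofReal (ρ ^ (e + 2)) * (4 * (e + 2 : ℕ) : ℝ≥0∞)⁻¹) := by gcongr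
      _ = _ := by
          rw [← mul_assoc, ← ENNReal.ofReal_mul (by positivity),
            inv_mul_cancel₀ (by positivity), ENNReal.ofReal_one, one_mul])
  refine ⟨bad, hbad, fun s hs hsb z hz => ?_⟩
  obtain ⟨h1, i, hi⟩ := abs_apply_sub_le_of_mem_frontier_openCube hz
  have hcoord : ∀ j, |(ρ⁻¹ • (z - y)) j| = ρ⁻¹ * |z j - y j| := by
    intro j
    rw [PiLp.smul_apply, smul_eq_mul, abs_mul, abs_of_pos (inv_pos.2 hρ)]
    rfl
  have := hgood s hs hsb (ρ⁻¹ • (z - y)) (fun j => by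
    rw [hcoord, inv_mul_le_iff₀ hρ, mul_comm]; exact h1 j) ⟨i, by
    rw [hcoord, hi]; field_simp⟩
  simp only [w', smul_smul, mul_inv_cancel₀ hρ.ne', one_smul, add_sub_cancel] at this
  rwa [abs_mul, abs_of_pos (inv_pos.2 hρ), inv_mul_le_iff₀ hρ, mul_comm] at this

theorem norm_fderiv_sub_inner_sub_const {n : ℕ} {w : Euc n → ℝ} (hw : Differentiable ℝ w)
    (ξ : Euc n) (c : ℝ) (z : Euc n) :
    ‖fderiv ℝ (fun z => w z - inner ℝ ξ z - c) z‖ = ‖gradient w z - ξ‖ := by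
  have h1 : HasFDerivAt (fun z => w z - inner ℝ ξ z - c) (fderiv ℝ w z - innerSL ℝ ξ) z :=
    ((hw z).hasFDerivAt.sub (innerSL ℝ ξ).hasFDerivAt).sub_const c
  rw [h1.fderiv, ← (InnerProductSpace.toDual ℝ (Euc n)).norm_map (gradient w z - ξ), map_sub]
  simp [gradient]
  rfl

theorem exists_frequently_notMem {bad : ℕ → Set ℝ} (h : ∀ k, volume (bad k) ≤ 2⁻¹) :
    ∃ s ∈ Ioo (1 : ℝ) 2, ∃ᶠ k in atTop, s ∉ bad k := by
  by_contra! hcon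
  have hsub : Ioo (1 : ℝ) 2 ⊆ ⋃ N : ℕ, ⋂ k ≥ N, bad k := by
    intro s hs
    have := hcon s hs
    obtain ⟨N, hN⟩ := eventually_atTop.1 this
    rw [mem_iUnion]
    exact ⟨N, mem_iInter₂.2 fun k hk => hN k hk⟩
  have hmono : Monotone fun N : ℕ => ⋂ k ≥ N, bad k := fun N N' hN =>
    biInter_subset_biInter_left fun k hk => le_trans hN hk
  have h1 := measure_mono (μ := volume) hsub
  rw [hmono.measure_iUnion, Real.volume_Ioo] at h1
  have h2 : ⨆ N : ℕ, volume (⋂ k ≥ N, bad k) ≤ 2⁻¹ :=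
    iSup_le fun N => (measure_mono (biInter_subset_of_mem (le_refl N))).trans (h N)
  have h3 := h1.trans h2
  norm_num at h3

theorem GrowthFn.convexOn_norm_sub {e : ℕ} {Φ : ℝ → ℝ} (h : GrowthFn e Φ) {E : Type*}
    [NormedAddCommGroup E] [NormedSpace ℝ E] (ξ : E) :
    ConvexOn ℝ univ fun v : E => Φ ‖v - ξ‖ := by
  refine ⟨convex_univ, fun x _ y _ a b ha hb hab => ?_⟩
  have h1 : ‖a • x + b • y - ξ‖ ≤ a * ‖x - ξ‖ + b * ‖y - ξ‖ := by
    have : a • x + b • y - ξ = a • (x - ξ) + b • (y - ξ) := by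
      have : ξ = (a + b) • ξ := by rw [hab, one_smul]
      nth_rewrite 1 [this]
      module
    rw [this]
    refine (norm_add_le _ _).trans ?_
    rw [norm_smul, norm_smul, Real.norm_of_nonneg ha, Real.norm_of_nonneg hb]
  refine (h.mono (mem_Ici.2 (norm_nonneg _)) (mem_Ici.2 (by positivity)) h1).trans ?_
  exact h.convex.2 (mem_univ _) (mem_univ _) ha hb hab

theorem GrowthFn.exists_ae_abs_sub_le {e : ℕ} {Φ : ℝ → ℝ} (hΦ : GrowthFn e Φ) :
    ∃ C₀ : ℝ, 0 ≤ C₀ ∧ ∀ (Ω O : Set (Euc (e + 2))) (u U : Euc (e + 2) → ℝ)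
      (G : Euc (e + 2) → Euc (e + 2)), WeaklyMonotone Ω u → MeasurableSet O → O ⊆ Ω →
      EqOn u U O → WeakGradIdentity O U G → Integrable U → Integrable G →
      ∀ (ξ : Euc (e + 2)) (c : ℝ), ∫⁻ z in O, ENNReal.ofReal (Φ ‖G z - ξ‖) < ∞ →
      ∀ (y : Euc (e + 2)) (ρ : ℝ), 0 < ρ → closedBall y ((e + 2 : ℕ) * (8 * ρ)) ⊆ O →
      ∫⁻ z in closedBall y ((e + 2 : ℕ) * (4 * ρ)),
        (ENNReal.ofReal ρ⁻¹ * ‖U z - inner ℝ ξ z - c‖ₑ + ENNReal.ofReal (Φ ‖G z - ξ‖)) <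
          ENNReal.ofReal (ρ ^ (e + 2)) * (4 * (e + 2 : ℕ) : ℝ≥0∞)⁻¹ →
      ∀ᵐ z ∂volume.restrict (ball y ρ),
        |u z - inner ℝ ξ y - c| ≤ (C₀ + 2 * (e + 2 : ℕ) * ‖ξ‖) * ρ := by
  obtain ⟨C₀, hC₀, hface⟩ := hΦ.exists_abs_le_frontier
  refine ⟨C₀, hC₀, ?_⟩
  have hn0 : (0 : ℝ) < ((e + 2 : ℕ) : ℝ) := by positivity
  revert hface hn0
  generalize e + 2 = n
  intro hface hn0 Ω O u U G hmon hO hOΩ huU hWG hU hG ξ c hF y ρ hρ hyO hI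
  set B := closedBall y ((n : ℝ) * (4 * ρ)) with hBdef
  have hBm : MeasurableSet B := isClosed_closedBall.measurableSet
  have hr : (0 : ℝ) < n * (4 * ρ) := by positivity
  have hBO : ∀ x ∈ B, closedBall x (n * (4 * ρ)) ⊆ O := fun x hx =>
    (closedBall_subset_closedBall' (by
      have := mem_closedBall.1 hx
      linarith [this])).trans hyO
  obtain ⟨w, hw, hlim, hlim', hconv⟩ := hWG.exists_smooth_approx hO hU hG hBm hr hBO
  have hev : ∀ᶠ k in atTop, ∃ bad : Set ℝ, volume bad ≤ 2⁻¹ ∧ ∀ s ∈ Ioo (1 : ℝ) 2, s ∉ bad →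
      ∀ z ∈ frontier (openCube y (s * ρ)), |w k z - inner ℝ ξ z - c| ≤ C₀ * ρ := by
    obtain ⟨δ, hδ0, hδ⟩ : ∃ δ : ℝ≥0∞, δ ≠ 0 ∧ (∫⁻ z in B, (ENNReal.ofReal ρ⁻¹ *
        ‖U z - inner ℝ ξ z - c‖ₑ + ENNReal.ofReal (Φ ‖G z - ξ‖))) + (δ + δ) ≤
        ENNReal.ofReal (ρ ^ n) * (4 * (n : ℕ) : ℝ≥0∞)⁻¹ := by
      refine ⟨(ENNReal.ofReal (ρ ^ n) * (4 * (n : ℕ) : ℝ≥0∞)⁻¹ - (∫⁻ z in B, (ENNReal.ofReal ρ⁻¹ *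
        ‖U z - inner ℝ ξ z - c‖ₑ + ENNReal.ofReal (Φ ‖G z - ξ‖)))) / 2, ?_, ?_⟩
      · exact (ENNReal.div_pos (tsub_pos_of_lt hI).ne' (by simp)).ne'
      · rw [ENNReal.add_halves, add_tsub_cancel_of_le hI.le]
    have h1 := hconv (fun v => Φ ‖v - ξ‖) (hΦ.convexOn_norm_sub ξ)
      (fun v => hΦ.nonneg (norm_nonneg _)) hF δ hδ0
    have h2 : ∀ᶠ k in atTop, ENNReal.ofReal ρ⁻¹ * ∫⁻ x, ‖w k x - U x‖ₑ ≤ δ := by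
      have := ENNReal.Tendsto.const_mul (a := ENNReal.ofReal ρ⁻¹) hlim (Or.inr (by simp))
      rw [mul_zero] at this
      exact (this.eventually (gt_mem_nhds (pos_iff_ne_zero.2 hδ0))).mono fun k hk => hk.le
    filter_upwards [h1, h2] with k hk1 hk2
    have hwd : Differentiable ℝ (w k) := (hw k).differentiable (by simp)
    refine hface (fun z => w k z - inner ℝ ξ z - c) ?_ y ρ hρ ?_
    · exact (((hw k).of_le (by exact_mod_cast le_top)).sub (innerSL ℝ ξ).contDiff).sub contDiff_const
    simp only [norm_fderiv_sub_inner_sub_const hwd ξ c]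
    have hUm : AEMeasurable (fun z => ENNReal.ofReal ρ⁻¹ * ‖U z - inner ℝ ξ z - c‖ₑ)
        (volume.restrict B) := by
      have h3 : AEMeasurable U (volume.restrict B) := hU.aestronglyMeasurable.aemeasurable.restrict
      have h4 : Measurable fun z : Euc n => inner ℝ ξ z := by fun_prop
      exact ((h3.sub h4.aemeasurable).sub_const c).enorm.const_mul _
    have hdm : Measurable fun z => ENNReal.ofReal ρ⁻¹ * ‖w k z - inner ℝ ξ z - c‖ₑ := by
      have h3 : Measurable (w k) := (hw k).continuous.measurable
      have h4 : Measurable fun z : Euc n => inner ℝ ξ z := by fun_prop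
      exact ((h3.sub h4).sub_const c).enorm.const_mul _
    rw [lintegral_add_left' hUm] at hδ
    calc ∫⁻ z in B, (ENNReal.ofReal ρ⁻¹ * ‖w k z - inner ℝ ξ z - c‖ₑ +
          ENNReal.ofReal (Φ ‖gradient (w k) z - ξ‖))
        = (∫⁻ z in B, ENNReal.ofReal ρ⁻¹ * ‖w k z - inner ℝ ξ z - c‖ₑ) +
          ∫⁻ z in B, ENNReal.ofReal (Φ ‖gradient (w k) z - ξ‖) := lintegral_add_left hdm _
      _ ≤ ((∫⁻ z in B, ENNReal.ofReal ρ⁻¹ * ‖U z - inner ℝ ξ z - c‖ₑ) + δ) +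
          ((∫⁻ z in B, ENNReal.ofReal (Φ ‖G z - ξ‖)) + δ) := by
          refine add_le_add ?_ (hk1 B hBm subset_rfl)
          calc _ ≤ ∫⁻ z in B, (ENNReal.ofReal ρ⁻¹ * ‖U z - inner ℝ ξ z - c‖ₑ +
                ENNReal.ofReal ρ⁻¹ * ‖w k z - U z‖ₑ) := by
                refine lintegral_mono fun z => ?_
                rw [← mul_add]
                gcongr
                rw [show w k z - inner ℝ ξ z - c = (U z - inner ℝ ξ z - c) + (w k z - U z) by ring]
                exact enorm_add_le _ _
            _ = (∫⁻ z in B, ENNReal.ofReal ρ⁻¹ * ‖U z - inner ℝ ξ z - c‖ₑ) +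
                ENNReal.ofReal ρ⁻¹ * ∫⁻ z in B, ‖w k z - U z‖ₑ := by
                rw [lintegral_add_left' hUm,
                  lintegral_const_mul' (ENNReal.ofReal ρ⁻¹) (fun z => ‖w k z - U z‖ₑ)
                    ENNReal.ofReal_ne_top]
            _ ≤ _ := by
                gcongr
                refine le_trans ?_ hk2
                exact mul_le_mul_right (setLIntegral_le_lintegral _ _) _
      _ ≤ _ := by
          refine le_of_eq_of_le ?_ hδ
          ring
  obtain ⟨N, hN⟩ := eventually_atTop.1 hev
  have hall : ∀ k, ∃ bad : Set ℝ, volume bad ≤ 2⁻¹ ∧ (N ≤ k → ∀ s ∈ Ioo (1 : ℝ) 2, s ∉ bad →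
      ∀ z ∈ frontier (openCube y (s * ρ)), |w k z - inner ℝ ξ z - c| ≤ C₀ * ρ) := by
    intro k
    by_cases hk : N ≤ k
    · obtain ⟨bad, h1, h2⟩ := hN k hk
      exact ⟨bad, h1, fun _ => h2⟩
    · exact ⟨∅, by simp, fun h => absurd h hk⟩
  choose bad hbad hgood using hall
  obtain ⟨s, hs, hfreq⟩ := exists_frequently_notMem hbad
  have hsρ : 0 ≤ s * ρ := by nlinarith [hs.1]
  have hclB : closure (openCube y (s * ρ)) ⊆ closedBall y (n * (2 * ρ)) :=
    (closure_openCube_subset_closedBall y hsρ).trans (closedBall_subset_closedBall (by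
      gcongr; exact hs.2.le))
  have hclB' : closure (openCube y (s * ρ)) ⊆ B :=
    hclB.trans (closedBall_subset_closedBall (by gcongr; norm_num))
  have hclO : closure (openCube y (s * ρ)) ⊆ O :=
    hclB.trans ((closedBall_subset_closedBall (by gcongr; norm_num)).trans hyO)
  have hQO : openCube y (s * ρ) ⊆ O := subset_closure.trans hclO
  have hQm := (isOpen_openCube y (s * ρ)).measurableSet
  set K : ℝ := (C₀ + 2 * n * ‖ξ‖) * ρ with hK
  have hK0 : 0 ≤ K := by positivity
  have hbound : ∃ᶠ k in atTop, ∀ z ∈ frontier (openCube y (s * ρ)),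
      w k z ∈ Icc (inner ℝ ξ y + c - K) (inner ℝ ξ y + c + K) := by
    refine (hfreq.and_eventually (eventually_ge_atTop N)).mono fun k hk z hz => ?_
    have h1 := abs_le.1 (hgood k hk.2 s hs hk.1 z hz)
    have h2 : |inner ℝ ξ (z - y)| ≤ ‖ξ‖ * (n * (2 * ρ)) := by
      refine (abs_real_inner_le_norm _ _).trans ?_
      gcongr
      have := hclB (frontier_subset_closure hz)
      rwa [mem_closedBall, dist_eq_norm] at this
    rw [inner_sub_right] at h2
    have h3 := abs_le.1 h2
    constructor <;> nlinarith [h1.1, h1.2, h3.1, h3.2]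
  have hfin := hmon.ae_mem_Icc_of_frontier (isOpen_openCube y (s * ρ))
    ((isCompact_closedBall _ _).of_isClosed_subset isClosed_closure hclB) (hclO.trans hOΩ)
    (G := G) (hU.integrableOn.congr_fun (fun z hz => (huU (hQO hz)).symm) hQm) hG.integrableOn hw
    (by
      refine tendsto_of_tendsto_of_tendsto_of_le_of_le tendsto_const_nhds hlim
        (fun _ => zero_le) fun k => ?_
      refine le_trans (le_of_eq (setLIntegral_congr_fun hQm fun z hz => ?_))
        (setLIntegral_le_lintegral (openCube y (s * ρ)) _)
      simp only [huU (hQO hz)])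
    (tendsto_of_tendsto_of_tendsto_of_le_of_le tendsto_const_nhds hlim'
      (fun _ => zero_le) fun k => lintegral_mono_set (subset_closure.trans hclB'))
    (by linarith) hbound
  have hsub : ball y ρ ⊆ openCube y (s * ρ) :=
    (ball_subset_ball (by nlinarith [hs.1])).trans (ball_subset_openCube y _)
  filter_upwards [ae_restrict_of_ae_restrict_of_subset hsub hfin] with z hz
  rw [abs_le]
  constructor <;> linarith [hz.1, hz.2]

theorem lintegral_comp_segment_le {n : ℕ} {B : Set (Euc n)} (hB : MeasurableSet B)
    (hconv : Convex ℝ B) {f : Euc n → ℝ≥0∞} (hf : Measurable f) {y : Euc n} (hy : y ∈ B) {t : ℝ}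
    (ht : 2⁻¹ ≤ t) (ht1 : t ≤ 1) :
    ∫⁻ z in B, f ((1 - t) • y + t • z) ≤ 2 ^ n * ∫⁻ z in B, f z := by
  have ht0 : 0 < t := lt_of_lt_of_le (by norm_num) ht
  have hg : Measurable fun z => B.indicator f ((1 - t) • y + z) :=
    (hf.indicator hB).comp (measurable_const_add _)
  calc ∫⁻ z in B, f ((1 - t) • y + t • z)
      ≤ ∫⁻ z, B.indicator f ((1 - t) • y + t • z) := by
        rw [← lintegral_indicator hB]
        refine lintegral_mono fun z => ?_
        by_cases hz : z ∈ B
        · rw [indicator_of_mem hz,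
            indicator_of_mem (hconv hy hz (by linarith) ht0.le (by ring))]
        · rw [indicator_of_notMem hz]; exact zero_le
    _ = ENNReal.ofReal ((t ^ n)⁻¹) * ∫⁻ z in B, f z := by
        rw [lintegral_comp_smul_euc hg ht0, lintegral_add_left_eq_self, lintegral_indicator hB]
    _ ≤ _ := by
        gcongr
        rw [← inv_pow, ← ENNReal.ofReal_ofNat 2, ← ENNReal.ofReal_pow (by norm_num)]
        refine ENNReal.ofReal_le_ofReal (pow_le_pow_left₀ (by positivity) ?_ n)
        rw [inv_le_comm₀ ht0 (by norm_num)]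
        exact ht

theorem lintegral_lintegral_enorm_sub_le {n : ℕ} {B : Set (Euc n)} (hB : MeasurableSet B)
    (hconv : Convex ℝ B) {D : ℝ} (hD : 0 ≤ D) (hBD : ∀ y ∈ B, ∀ z ∈ B, ‖z - y‖ ≤ D)
    {w : Euc n → ℝ} (hw : ContDiff ℝ 1 w) :
    ∫⁻ y in B, ∫⁻ z in B, ‖w y - w z‖ₑ ≤
      ENNReal.ofReal D * 2 ^ n * volume B * ∫⁻ z in B, ENNReal.ofReal ‖fderiv ℝ w z‖ := by
  have hcf : Continuous (fderiv ℝ w) := hw.continuous_fderiv (by simp)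
  let f : Euc n → ℝ≥0∞ := fun z => ENNReal.ofReal ‖fderiv ℝ w z‖
  have hf : Measurable f := hcf.norm.measurable.ennreal_ofReal
  have hmeas : Measurable fun q : (Euc n × Euc n) × ℝ => f ((1 - q.2) • q.1.1 + q.2 • q.1.2) :=
    hf.comp (by fun_prop)
  have hpt : ∀ y ∈ B, ∀ z ∈ B, ‖w y - w z‖ₑ ≤
      ENNReal.ofReal D * ∫⁻ t in Ioo (0 : ℝ) 1, f ((1 - t) • y + t • z) := by
    intro y hy z hz
    have := enorm_le_enorm_add_lintegral_of_fderiv_le (w := fun y => w y - w z)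
      (a := fun y => ‖fderiv ℝ w y‖) (C := 1) (hw.sub contDiff_const) zero_le_one (fun y => by
        rw [fderiv_sub_const, one_mul]) hD y (hBD y hy z hz)
    simp only [add_sub_cancel, sub_self, enorm_zero, zero_add, mul_one] at this
    refine this.trans (le_of_eq ?_)
    congr 1
    refine lintegral_congr fun t => ?_
    simp only [f]
    rw [show y + t • (z - y) = (1 - t) • y + t • z by module]
  have hslice : ∀ t ∈ Ioo (0 : ℝ) 1, ∫⁻ y in B, ∫⁻ z in B, f ((1 - t) • y + t • z) ≤
      2 ^ n * volume B * ∫⁻ z in B, f z := by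
    intro t ht
    have hconst : ∫⁻ _ in B, 2 ^ n * ∫⁻ z in B, f z = 2 ^ n * volume B * ∫⁻ z in B, f z := by
      rw [setLIntegral_const]; ring
    rw [← hconst]
    rcases le_total 2⁻¹ t with h | h
    · exact setLIntegral_mono' hB fun y hy => lintegral_comp_segment_le hB hconv hf hy h ht.2.le
    · rw [lintegral_lintegral_swap (by
        refine Measurable.aemeasurable (hf.comp ?_)
        fun_prop)]
      refine setLIntegral_mono' hB fun z hz => ?_
      have := lintegral_comp_segment_le hB hconv hf hz (t := 1 - t) (by norm_num at h ⊢; linarith)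
        (by linarith [ht.1])
      simpa [add_comm] using this
  calc ∫⁻ y in B, ∫⁻ z in B, ‖w y - w z‖ₑ
      ≤ ∫⁻ y in B, ∫⁻ z in B, ENNReal.ofReal D * ∫⁻ t in Ioo (0 : ℝ) 1, f ((1 - t) • y + t • z) :=
        setLIntegral_mono' hB fun y hy => setLIntegral_mono' hB fun z hz => hpt y hy z hz
    _ = ENNReal.ofReal D * ∫⁻ y in B, ∫⁻ z in B, ∫⁻ t in Ioo (0 : ℝ) 1, f ((1 - t) • y + t • z) := by
        simp_rw [lintegral_const_mul' _ _ ENNReal.ofReal_ne_top]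
    _ = ENNReal.ofReal D * ∫⁻ t in Ioo (0 : ℝ) 1, ∫⁻ y in B, ∫⁻ z in B, f ((1 - t) • y + t • z) := by
        congr 1
        have h1 : ∀ y, ∫⁻ z in B, ∫⁻ t in Ioo (0 : ℝ) 1, f ((1 - t) • y + t • z) =
            ∫⁻ t in Ioo (0 : ℝ) 1, ∫⁻ z in B, f ((1 - t) • y + t • z) := fun y =>
          lintegral_lintegral_swap (Measurable.aemeasurable (hf.comp (by fun_prop)))
        simp_rw [h1]
        refine lintegral_lintegral_swap (Measurable.aemeasurable ?_)
        have hm' : Measurable fun q : (Euc n × ℝ) × Euc n => f ((1 - q.1.2) • q.1.1 + q.1.2 • q.2) :=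
          hf.comp (by fun_prop)
        exact hm'.lintegral_prod_right'
    _ ≤ ENNReal.ofReal D * ∫⁻ t in Ioo (0 : ℝ) 1, 2 ^ n * volume B * ∫⁻ z in B, f z := by
        exact mul_le_mul_right (setLIntegral_mono' measurableSet_Ioo hslice) _
    _ = _ := by
        rw [setLIntegral_const, Real.volume_Ioo]
        simp only [sub_zero, ENNReal.ofReal_one, mul_one, f]
        ring

theorem exists_lintegral_enorm_sub_le {n : ℕ} {B : Set (Euc n)} (hB : MeasurableSet B)
    (hconv : Convex ℝ B) (h0 : volume B ≠ 0) (hfin : volume B ≠ ∞)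
    {D : ℝ} (hD : 0 ≤ D) (hBD : ∀ y ∈ B, ∀ z ∈ B, ‖z - y‖ ≤ D)
    {w : Euc n → ℝ} (hw : ContDiff ℝ 1 w) :
    ∃ c : ℝ, ∫⁻ z in B, ‖w z - c‖ₑ ≤
      ENNReal.ofReal D * 2 ^ n * ∫⁻ z in B, ENNReal.ofReal ‖fderiv ℝ w z‖ := by
  have hm : Measurable fun q : Euc n × Euc n => ‖w q.1 - w q.2‖ₑ := by
    have := hw.continuous
    exact (by fun_prop : Continuous fun q : Euc n × Euc n => w q.1 - w q.2).measurable.enorm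
  obtain ⟨y, hy, h⟩ := exists_le_setLAverage (f := fun y => ∫⁻ z in B, ‖w y - w z‖ₑ) h0 hfin
    (Measurable.aemeasurable hm.lintegral_prod_right')
  refine ⟨w y, ?_⟩
  simp_rw [fun z => enorm_sub_rev (w z) (w y)]
  refine h.trans ?_
  rw [setLAverage_eq, ENNReal.div_le_iff h0 hfin]
  refine (lintegral_lintegral_enorm_sub_le hB hconv hD hBD hw).trans (le_of_eq ?_)
  ring

theorem WeakGradIdentity.exists_lintegral_enorm_sub_inner_le {n : ℕ} {O : Set (Euc n)}
    (hO : MeasurableSet O) {U : Euc n → ℝ} {G : Euc n → Euc n} (h : WeakGradIdentity O U G)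
    (hU : Integrable U) (hG : Integrable G) {x : Euc n} {R : ℝ} (hR : 0 < R)
    (hx : closedBall x (2 * R) ⊆ O) (ξ : Euc n) {δ : ℝ≥0∞} (hδ : δ ≠ 0) :
    ∃ c : ℝ, ∫⁻ z in ball x R, ‖U z - inner ℝ ξ z - c‖ₑ ≤
      ENNReal.ofReal (2 * R) * 2 ^ n * (∫⁻ z in ball x R, ENNReal.ofReal ‖G z - ξ‖) + δ := by
  have hBm : MeasurableSet (ball x R) := isOpen_ball.measurableSet
  obtain ⟨w, hw, hlim, hlim', -⟩ := h.exists_smooth_approx hO hU hG hBm hR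
    (fun z hz => (closedBall_subset_closedBall' (by
      have := mem_ball.1 hz
      linarith [this])).trans hx)
  set K : ℝ≥0∞ := ENNReal.ofReal (2 * R) * 2 ^ n with hK
  have hKfin : K ≠ ∞ := by finiteness
  have hδ2 : 0 < δ / 2 := ENNReal.half_pos hδ
  have h1 := ENNReal.Tendsto.const_mul (a := K) hlim' (Or.inr hKfin)
  rw [mul_zero] at h1
  obtain ⟨k, hk1, hk2⟩ := ((h1.eventually (gt_mem_nhds hδ2)).and
    (hlim.eventually (gt_mem_nhds hδ2))).exists
  have hwd : Differentiable ℝ (w k) := (hw k).differentiable (by simp)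
  have hcd : ContDiff ℝ 1 fun z => w k z - inner ℝ ξ z :=
    ((hw k).of_le (by exact_mod_cast le_top)).sub (innerSL ℝ ξ).contDiff
  obtain ⟨c, hc⟩ := exists_lintegral_enorm_sub_le hBm (convex_ball x R)
    (measure_ball_pos volume x hR).ne' measure_ball_lt_top.ne (D := 2 * R) (by positivity)
    (fun y hy z hz => by
      rw [← dist_eq_norm]
      have h1 := mem_ball.1 hy
      have h2 := mem_ball.1 hz
      linarith [dist_triangle_right z y x]) hcd
  have hfd : ∀ z, ‖fderiv ℝ (fun z => w k z - inner ℝ ξ z) z‖ = ‖gradient (w k) z - ξ‖ := by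
    intro z
    have := norm_fderiv_sub_inner_sub_const hwd ξ 0 z
    simpa only [sub_zero] using this
  simp only [hfd] at hc
  refine ⟨c, ?_⟩
  have hm : Measurable fun z => ‖w k z - inner ℝ ξ z - c‖ₑ :=
    (hcd.continuous.sub continuous_const).measurable.enorm
  have hGm : AEMeasurable (fun z => ENNReal.ofReal ‖G z - ξ‖) (volume.restrict (ball x R)) :=
    ((hG.aestronglyMeasurable.aemeasurable.sub_const ξ).norm.ennreal_ofReal).restrict
  calc ∫⁻ z in ball x R, ‖U z - inner ℝ ξ z - c‖ₑ
      ≤ ∫⁻ z in ball x R, (‖w k z - inner ℝ ξ z - c‖ₑ + ‖w k z - U z‖ₑ) := by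
        refine lintegral_mono fun z => ?_
        rw [enorm_sub_rev (w k z), show U z - inner ℝ ξ z - c =
          (w k z - inner ℝ ξ z - c) + (U z - w k z) by ring]
        exact enorm_add_le _ _
    _ = (∫⁻ z in ball x R, ‖w k z - inner ℝ ξ z - c‖ₑ) + ∫⁻ z in ball x R, ‖w k z - U z‖ₑ :=
        lintegral_add_left hm _
    _ ≤ K * (∫⁻ z in ball x R, ENNReal.ofReal ‖gradient (w k) z - ξ‖) + δ / 2 :=
        add_le_add hc ((setLIntegral_le_lintegral _ _).trans hk2.le)
    _ ≤ K * ((∫⁻ z in ball x R, ENNReal.ofReal ‖G z - ξ‖) +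
          ∫⁻ z in ball x R, ‖gradient (w k) z - G z‖ₑ) + δ / 2 := by
        gcongr
        rw [← lintegral_add_left' hGm]
        refine lintegral_mono fun z => ?_
        beta_reduce
        rw [ofReal_norm, ofReal_norm, show gradient (w k) z - ξ =
          (G z - ξ) + (gradient (w k) z - G z) by abel]
        exact enorm_add_le _ _
    _ ≤ K * (∫⁻ z in ball x R, ENNReal.ofReal ‖G z - ξ‖) + (δ / 2 + δ / 2) := by
        rw [mul_add, add_assoc]
        gcongr
    _ = _ := by rw [ENNReal.add_halves]

theorem GrowthFn.half_le_add {e : ℕ} {Φ : ℝ → ℝ} (h : GrowthFn e Φ) {v a b : ℝ} (hv : 0 ≤ v)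
    (ha : 0 ≤ a) (hb : 0 ≤ b) (hle : v ≤ a + b) : Φ (v / 2) ≤ Φ a + Φ b := by
  have h1 : Φ (v / 2) ≤ Φ ((1 / 2 : ℝ) • a + (1 / 2 : ℝ) • b) := by
    refine h.mono (mem_Ici.2 (by positivity)) (mem_Ici.2 (by positivity)) ?_
    simp only [smul_eq_mul]
    linarith
  have h2 := h.convex.2 (mem_univ a) (mem_univ b) (by norm_num : (0 : ℝ) ≤ 1 / 2)
    (by norm_num : (0 : ℝ) ≤ 1 / 2) (by norm_num)
  simp only [smul_eq_mul] at h1 h2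
  linarith [h.nonneg ha, h.nonneg hb]

theorem GrowthFn.lintegral_half_norm_sub_lt_top {e : ℕ} {Φ : ℝ → ℝ} (h : GrowthFn e Φ) {n : ℕ}
    {O : Set (Euc n)} (hO : volume O ≠ ∞) {G : Euc n → Euc n}
    (hI : ∫⁻ z in O, ENNReal.ofReal (Φ ‖G z‖) < ∞) (ξ : Euc n) :
    ∫⁻ z in O, ENNReal.ofReal (Φ (‖G z - ξ‖ / 2)) < ∞ := by
  calc _ ≤ ∫⁻ z in O, (ENNReal.ofReal (Φ ‖G z‖) + ENNReal.ofReal (Φ ‖ξ‖)) := by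
        refine lintegral_mono fun z => ?_
        rw [← ENNReal.ofReal_add (h.nonneg (norm_nonneg _)) (h.nonneg (norm_nonneg _))]
        exact ENNReal.ofReal_le_ofReal (h.half_le_add (norm_nonneg _) (norm_nonneg _)
          (norm_nonneg _) (norm_sub_le _ _))
    _ = (∫⁻ z in O, ENNReal.ofReal (Φ ‖G z‖)) + ENNReal.ofReal (Φ ‖ξ‖) * volume O := by
        rw [lintegral_add_right _ measurable_const, setLIntegral_const]
    _ < ∞ := ENNReal.add_lt_top.2 ⟨hI, ENNReal.mul_lt_top ENNReal.ofReal_lt_top hO.lt_top⟩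

theorem GrowthFn.ae_tendsto_lintegral_div {e : ℕ} {Φ : ℝ → ℝ} (h : GrowthFn e Φ) {n : ℕ}
    {O : Set (Euc n)} (hO : IsOpen O) (hfin : volume O ≠ ∞) {G : Euc n → Euc n}
    (hG : AEMeasurable G) (hI : ∫⁻ z in O, ENNReal.ofReal (Φ ‖G z‖) < ∞) :
    ∀ᵐ x ∂volume.restrict O, Tendsto (fun r => (∫⁻ z in closedBall x r,
      ENNReal.ofReal (Φ (‖G z - G x‖ / 4))) / volume (closedBall x r)) (𝓝[>] 0) (𝓝 0) := by
  obtain ⟨D, hDc, hDd⟩ := TopologicalSpace.exists_countable_dense (Euc n)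
  let f : Euc n → Euc n → ℝ≥0∞ := fun ξ => O.indicator fun z => ENNReal.ofReal (Φ (‖G z - ξ‖ / 2))
  have hfm : ∀ ξ, AEMeasurable (f ξ) := fun ξ =>
    ((h.continuous.measurable.comp_aemeasurable
      ((hG.sub_const ξ).norm.div_const 2)).ennreal_ofReal).indicator hO.measurableSet
  have hall : ∀ᵐ x ∂(volume : Measure (Euc n)), ∀ ξ ∈ D, Tendsto (fun a => (∫⁻ y in a, f ξ y) / volume a)
      ((Besicovitch.vitaliFamily volume).filterAt x) (𝓝 (f ξ x)) := by
    rw [ae_ball_iff hDc]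
    intro ξ _
    refine (Besicovitch.vitaliFamily volume).ae_tendsto_lintegral_div (hfm ξ) ?_
    rw [lintegral_indicator hO.measurableSet]
    exact (h.lintegral_half_norm_sub_lt_top hfin hI ξ).ne
  rw [ae_restrict_iff' hO.measurableSet]
  filter_upwards [hall] with x hx hxO
  rw [ENNReal.tendsto_nhds_zero]
  intro ε hε
  obtain ⟨ξ, hξD, hξ⟩ : ∃ ξ ∈ D, ENNReal.ofReal (Φ (‖G x - ξ‖ / 2)) < ε / 2 := by
    have hc : Continuous fun ξ : Euc n => ENNReal.ofReal (Φ (‖G x - ξ‖ / 2)) :=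
      ENNReal.continuous_ofReal.comp (h.continuous.comp (by fun_prop))
    have hop : IsOpen {ξ : Euc n | ENNReal.ofReal (Φ (‖G x - ξ‖ / 2)) < ε / 2} :=
      isOpen_lt hc continuous_const
    obtain ⟨ξ, h1, h2⟩ := hDd.exists_mem_open hop ⟨G x, by
      simp [h.zero, hε.ne']⟩
    exact ⟨ξ, h1, h2⟩
  have hlim := (hx ξ hξD).comp (Besicovitch.tendsto_filterAt volume x)
  have hfx : f ξ x < ε / 2 := by simpa only [f, indicator_of_mem hxO] using hξ
  obtain ⟨r₀, hr₀, hr₀O⟩ := Metric.isOpen_iff.1 hO x hxO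
  filter_upwards [hlim.eventually (gt_mem_nhds hfx), Ioo_mem_nhdsGT hr₀] with r hr1 hr2
  have hrO : closedBall x r ⊆ O := (closedBall_subset_ball hr2.2).trans hr₀O
  have hcb : MeasurableSet (closedBall x r) := isClosed_closedBall.measurableSet
  have hv0 : volume (closedBall x r) ≠ 0 := (measure_closedBall_pos volume x hr2.1).ne'
  have hvt : volume (closedBall x r) ≠ ∞ := measure_closedBall_lt_top.ne
  have hintg : ∫⁻ z in closedBall x r, ENNReal.ofReal (Φ (‖G z - G x‖ / 4)) ≤
      (∫⁻ z in closedBall x r, f ξ z) + ε / 2 * volume (closedBall x r) := by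
    rw [← setLIntegral_const, ← lintegral_add_right _ measurable_const]
    refine setLIntegral_mono' hcb fun z hz => ?_
    simp only [f, indicator_of_mem (hrO hz)]
    refine le_trans ?_ (add_le_add le_rfl hξ.le)
    rw [← ENNReal.ofReal_add (h.nonneg (by positivity)) (h.nonneg (by positivity))]
    refine ENNReal.ofReal_le_ofReal ?_
    rw [show ‖G z - G x‖ / 4 = ‖G z - G x‖ / 2 / 2 by ring]
    refine h.half_le_add (by positivity) (by positivity) (by positivity) ?_
    have := norm_sub_le_norm_sub_add_norm_sub (G z) ξ (G x)
    rw [norm_sub_rev ξ] at this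
    linarith
  calc _ ≤ ((∫⁻ z in closedBall x r, f ξ z) + ε / 2 * volume (closedBall x r)) /
        volume (closedBall x r) := ENNReal.div_le_div_right hintg _
    _ = (∫⁻ z in closedBall x r, f ξ z) / volume (closedBall x r) + ε / 2 := by
        rw [ENNReal.add_div, ENNReal.mul_div_cancel_right hv0 hvt]
    _ ≤ ε / 2 + ε / 2 := add_le_add hr1.le le_rfl
    _ = ε := ENNReal.add_halves ε

theorem avgLimsupRep_mem_Icc {n : ℕ} {u : Euc n → ℝ} {y : Euc n} {ρ a b : ℝ} (hρ : 0 < ρ)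
    (hu : IntegrableOn u (ball y ρ)) (h : ∀ᵐ z ∂volume.restrict (ball y ρ), u z ∈ Icc a b) :
    avgLimsupRep u y ∈ Icc a b := by
  have hev : ∀ᶠ t in 𝓝[>] (0 : ℝ), (⨍ z in ball y t, u z) ∈ Icc a b := by
    filter_upwards [Ioo_mem_nhdsGT hρ] with t ht
    have hsub : ball y t ⊆ ball y ρ := ball_subset_ball ht.2.le
    exact (convex_Icc a b).set_average_mem isClosed_Icc (measure_ball_pos volume y ht.1).ne'
      measure_ball_lt_top.ne (ae_restrict_of_ae_restrict_of_subset hsub h) (hu.mono_set hsub)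
  have hle : ∀ᶠ t in 𝓝[>] (0 : ℝ), (⨍ z in ball y t, u z) ≤ b := hev.mono fun _ h => h.2
  have hge : ∀ᶠ t in 𝓝[>] (0 : ℝ), a ≤ (⨍ z in ball y t, u z) := hev.mono fun _ h => h.1
  constructor
  · exact le_limsup_of_frequently_le hge.frequently ⟨b, hle⟩
  · exact limsup_le_of_le (IsBoundedUnder.isCoboundedUnder_le ⟨a, hge⟩) hle

theorem hasGradientAt_avgLimsupRep {n : ℕ} {u : Euc n → ℝ} {x ξ : Euc n} {O : Set (Euc n)}
    (hO : IsOpen O) (hx : x ∈ O) (hu : IntegrableOn u O) {K : ℝ} (hK : 0 ≤ K)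
    (h : ∀ ε ∈ Ioc (0 : ℝ) 1, ∀ᶠ r in 𝓝[>] (0 : ℝ), ∃ c : ℝ, ∀ y ∈ closedBall x r,
      ∀ᵐ z ∂volume.restrict (ball y (ε * r)), |u z - inner ℝ ξ y - c| ≤ K * (ε * r)) :
    HasGradientAt (avgLimsupRep u) ξ x := by
  rw [hasGradientAt_iff_hasFDerivAt]
  refine HasFDerivAt.of_isLittleO ?_
  rw [Asymptotics.isLittleO_iff]
  intro c' hc'
  set ε : ℝ := min 1 (c' / (2 * K + 1)) with hε
  have hε0 : 0 < ε := by positivity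
  have hεc : 2 * K * ε ≤ c' := by
    have h1 : ε ≤ c' / (2 * K + 1) := min_le_right _ _
    rw [le_div_iff₀ (by positivity)] at h1
    nlinarith
  obtain ⟨r₀, hr₀, hr₀O⟩ := Metric.isOpen_iff.1 hO x hx
  obtain ⟨r₁, hr₁, hr₁P⟩ := mem_nhdsGT_iff_exists_Ioo_subset.1 (h ε ⟨hε0, min_le_left _ _⟩)
  filter_upwards [ball_mem_nhds x (show 0 < min (r₀ / 2) r₁ by
    have : 0 < r₁ := hr₁
    positivity)] with y hy
  rcases eq_or_ne y x with rfl | hyx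
  · simp
  rw [mem_ball, dist_eq_norm] at hy
  have hr : 0 < ‖y - x‖ := norm_pos_iff.2 (sub_ne_zero.2 hyx)
  obtain ⟨c, hc⟩ := hr₁P ⟨hr, hy.trans_le (min_le_right _ _)⟩
  have hρ : 0 < ε * ‖y - x‖ := by positivity
  have hρr : ε * ‖y - x‖ ≤ ‖y - x‖ := mul_le_of_le_one_left hr.le (min_le_left _ _)
  have hkey : ∀ z ∈ closedBall x ‖y - x‖, avgLimsupRep u z ∈
      Icc (inner ℝ ξ z + c - K * (ε * ‖y - x‖)) (inner ℝ ξ z + c + K * (ε * ‖y - x‖)) := by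
    intro z hz
    refine avgLimsupRep_mem_Icc hρ (hu.mono_set ?_) ?_
    · refine (ball_subset_ball' ?_).trans hr₀O
      have := mem_closedBall.1 hz
      have := hy.trans_le (min_le_left _ _)
      linarith
    · filter_upwards [hc z hz] with v hv
      rw [abs_le] at hv
      constructor <;> linarith [hv.1, hv.2]
  have h1 := hkey y (by rw [mem_closedBall, dist_eq_norm])
  have h2 := hkey x (mem_closedBall_self hr.le)
  have h3 : (InnerProductSpace.toDual ℝ (Euc n) ξ) (y - x) = inner ℝ ξ y - inner ℝ ξ x := by
    rw [InnerProductSpace.toDual_apply_apply, inner_sub_right]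
  rw [h3, Real.norm_eq_abs]
  have h4 : 2 * K * ε * ‖y - x‖ ≤ c' * ‖y - x‖ := by gcongr
  refine le_trans ?_ h4
  rw [abs_le]
  constructor <;> linarith [h1.1, h1.2, h2.1, h2.2]

theorem WeaklyMonotone.hasGradientAt_avgLimsupRep {e : ℕ} {Φ : ℝ → ℝ} (hΦ : GrowthFn e Φ)
    {Ω O : Set (Euc (e + 2))} {u U : Euc (e + 2) → ℝ} {G : Euc (e + 2) → Euc (e + 2)}
    (hmon : WeaklyMonotone Ω u) (hO : IsOpen O) (hOΩ : O ⊆ Ω) (huU : EqOn u U O)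
    (hWG : WeakGradIdentity O U G) (hU : Integrable U) (hG : Integrable G) {x : Euc (e + 2)}
    (hx : x ∈ O) (hF : ∫⁻ z in O, ENNReal.ofReal (Φ ‖G z - G x‖) < ∞)
    (hlim : Tendsto (fun r => (∫⁻ z in closedBall x r, ENNReal.ofReal (Φ ‖G z - G x‖)) /
      volume (closedBall x r)) (𝓝[>] 0) (𝓝 0)) :
    HasGradientAt (avgLimsupRep u) (G x) x := by
  obtain ⟨C₀, hC₀, hmain⟩ := hΦ.exists_ae_abs_sub_le
  obtain ⟨c₁, hc₁, hlin⟩ := hΦ.linear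
  have hn0 : (1 : ℝ) ≤ ((e + 2 : ℕ) : ℝ) := by push_cast; linarith [(Nat.cast_nonneg e : (0 : ℝ) ≤ e)]
  have hΦm := hΦ.continuous.measurable
  have hΦ0 : ∀ t, 0 ≤ t → 0 ≤ Φ t := fun t ht => hΦ.nonneg ht
  revert hmain hn0
  generalize e + 2 = n at *
  intro hmain hn1
  have hn0 : (0 : ℝ) < n := by linarith
  refine _root_.hasGradientAt_avgLimsupRep hO hx
    (hU.integrableOn.congr_fun (fun z hz => (huU hz).symm) hO.measurableSet)
    (K := C₀ + 2 * n * ‖G x‖) (by positivity) fun ε hε => ?_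
  have hε0 : 0 < ε := hε.1
  set ξ := G x with hξ
  set V : ℝ≥0∞ := volume (ball (0 : Euc n) 1) with hV
  set M : ℝ≥0∞ := (ENNReal.ofReal (12 * n / ε) * 2 ^ n * ENNReal.ofReal c₁ + 1) *
    (ENNReal.ofReal ((6 * n) ^ n) * V) + 1 with hM
  set T : ℝ≥0∞ := ENNReal.ofReal (ε ^ n) * (4 * (n : ℕ) : ℝ≥0∞)⁻¹ with hT
  have hVfin : V ≠ ∞ := measure_ball_lt_top.ne
  have hMfin : M ≠ ∞ := by finiteness
  have hM0 : M ≠ 0 := by simp [hM]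
  have hT0 : T ≠ 0 := by
    refine mul_ne_zero (ENNReal.ofReal_pos.2 (by positivity)).ne' ?_
    exact ENNReal.inv_ne_zero.2 (by finiteness)
  have hTfin : T ≠ ∞ := by
    refine ENNReal.mul_ne_top ENNReal.ofReal_ne_top (ENNReal.inv_ne_top.2 ?_)
    refine mul_ne_zero (by norm_num) ?_
    have : n ≠ 0 := by rintro rfl; simp at hn0
    exact_mod_cast this
  obtain ⟨η, hη0, hηM⟩ : ∃ η : ℝ≥0∞, 0 < η ∧ η * M < T := by
    refine ⟨T / 2 / M, ENNReal.div_pos (ENNReal.half_pos hT0).ne' hMfin, ?_⟩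
    rw [ENNReal.div_mul_cancel hM0 hMfin]
    exact ENNReal.half_lt_self hT0 hTfin
  obtain ⟨r₀, hr₀, hr₀O⟩ := Metric.isOpen_iff.1 hO x hx
  have hscale : Tendsto (fun r : ℝ => 6 * n * r) (𝓝[>] 0) (𝓝[>] 0) := by
    refine tendsto_nhdsWithin_iff.2 ⟨?_, ?_⟩
    · have : Tendsto (fun r : ℝ => 6 * n * r) (𝓝 0) (𝓝 (6 * n * 0)) :=
        (continuous_const.mul continuous_id).tendsto 0
      rw [mul_zero] at this
      exact this.mono_left nhdsWithin_le_nhds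
    · filter_upwards [self_mem_nhdsWithin] with r hr
      have : 0 < r := hr
      exact mem_Ioi.2 (by positivity)
  have hd : (0 : ℝ) < r₀ / (12 * n) := by positivity
  filter_upwards [(hlim.comp hscale).eventually (gt_mem_nhds hη0), Ioo_mem_nhdsGT hd] with r hr hr2
  have hr0 : 0 < r := hr2.1
  have hrr₀ : 12 * n * r < r₀ := by
    have := (lt_div_iff₀ (by positivity)).1 hr2.2
    linarith
  have hR : (0 : ℝ) < 6 * n * r := by positivity
  have hρ : 0 < ε * r := by positivity
  have hρr : ε * r ≤ r := mul_le_of_le_one_left hr0.le hε.2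
  have hnρ : n * (ε * r) ≤ n * r := by gcongr
  have hrn : r ≤ n * r := le_mul_of_one_le_left hr0.le hn1
  set I : ℝ≥0∞ := ∫⁻ z in ball x (6 * n * r), ENNReal.ofReal (Φ ‖G z - ξ‖) with hI
  have hIle : I ≤ η * (ENNReal.ofReal (r ^ n) * (ENNReal.ofReal ((6 * n) ^ n) * V)) := by
    have hvol : volume (closedBall x (6 * n * r)) =
        ENNReal.ofReal (r ^ n) * (ENNReal.ofReal ((6 * n) ^ n) * V) := by
      rw [Measure.addHaar_closedBall _ _ hR.le, ← mul_assoc, ← ENNReal.ofReal_mul (by positivity),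
        finrank_euclideanSpace_fin, mul_pow (6 * (n : ℝ)),
        mul_comm ((6 * (n : ℝ)) ^ n)]
    rw [← hvol]
    refine (lintegral_mono_set ball_subset_closedBall).trans ?_
    have h1 := hr.le
    simp only [Function.comp_apply] at h1
    rwa [ENNReal.div_le_iff (measure_closedBall_pos volume x hR).ne'
      measure_closedBall_lt_top.ne] at h1
  have hδ : ENNReal.ofReal (ε * r) * (η * ENNReal.ofReal (r ^ n)) ≠ 0 := by
    refine mul_ne_zero (ENNReal.ofReal_pos.2 hρ).ne' (mul_ne_zero hη0.ne' ?_)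
    exact (ENNReal.ofReal_pos.2 (by positivity)).ne'
  obtain ⟨c, hc⟩ := hWG.exists_lintegral_enorm_sub_inner_le hO.measurableSet hU hG hR
    ((closedBall_subset_ball (by linarith)).trans hr₀O) ξ hδ
  have hGlin : ∫⁻ z in ball x (6 * n * r), ENNReal.ofReal ‖G z - ξ‖ ≤ ENNReal.ofReal c₁ * I := by
    rw [hI, ← lintegral_const_mul' _ _ ENNReal.ofReal_ne_top]
    refine lintegral_mono fun z => ?_
    rw [← ENNReal.ofReal_mul hc₁.le]
    exact ENNReal.ofReal_le_ofReal (hlin _ (norm_nonneg _))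
  refine ⟨c, fun y hy => ?_⟩
  have hyx : dist y x ≤ r := mem_closedBall.1 hy
  refine hmain Ω O u U G hmon hO.measurableSet hOΩ huU hWG hU hG ξ c hF y (ε * r) hρ
    ((closedBall_subset_ball' (by nlinarith)).trans hr₀O) ?_
  have hsub : closedBall y (n * (4 * (ε * r))) ⊆ ball x (6 * n * r) :=
    closedBall_subset_ball' (by nlinarith)
  have hUm : AEMeasurable (fun z => ENNReal.ofReal (ε * r)⁻¹ * ‖U z - inner ℝ ξ z - c‖ₑ)
      (volume.restrict (ball x (6 * n * r))) := by
    have h3 : AEMeasurable U (volume.restrict (ball x (6 * n * r))) :=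
      hU.aestronglyMeasurable.aemeasurable.restrict
    have h4 : Measurable fun z : Euc n => inner ℝ ξ z := by fun_prop
    exact ((h3.sub h4.aemeasurable).sub_const c).enorm.const_mul _
  have e1 : ENNReal.ofReal (ε * r)⁻¹ * ENNReal.ofReal (2 * (6 * n * r)) =
      ENNReal.ofReal (12 * n / ε) := by
    rw [← ENNReal.ofReal_mul (by positivity)]
    congr 1
    field_simp
    ring
  have e2 : ENNReal.ofReal (ε * r)⁻¹ * ENNReal.ofReal (ε * r) = 1 := by
    rw [← ENNReal.ofReal_mul (by positivity), inv_mul_cancel₀ hρ.ne', ENNReal.ofReal_one]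
  calc ∫⁻ z in closedBall y (n * (4 * (ε * r))),
        (ENNReal.ofReal (ε * r)⁻¹ * ‖U z - inner ℝ ξ z - c‖ₑ + ENNReal.ofReal (Φ ‖G z - ξ‖))
      ≤ ∫⁻ z in ball x (6 * n * r),
        (ENNReal.ofReal (ε * r)⁻¹ * ‖U z - inner ℝ ξ z - c‖ₑ + ENNReal.ofReal (Φ ‖G z - ξ‖)) :=
        lintegral_mono_set hsub
    _ = ENNReal.ofReal (ε * r)⁻¹ * (∫⁻ z in ball x (6 * n * r), ‖U z - inner ℝ ξ z - c‖ₑ) + I := by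
        rw [lintegral_add_left' hUm, lintegral_const_mul' _ _ ENNReal.ofReal_ne_top]
    _ ≤ ENNReal.ofReal (ε * r)⁻¹ * (ENNReal.ofReal (2 * (6 * n * r)) * 2 ^ n *
          (ENNReal.ofReal c₁ * I) + ENNReal.ofReal (ε * r) * (η * ENNReal.ofReal (r ^ n))) + I := by
        gcongr
        exact hc.trans (by gcongr)
    _ = ENNReal.ofReal (ε * r)⁻¹ * ENNReal.ofReal (2 * (6 * n * r)) * 2 ^ n * ENNReal.ofReal c₁ * I
          + ENNReal.ofReal (ε * r)⁻¹ * ENNReal.ofReal (ε * r) * (η * ENNReal.ofReal (r ^ n)) + I := by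
        ring
    _ = (ENNReal.ofReal (12 * n / ε) * 2 ^ n * ENNReal.ofReal c₁ + 1) * I +
          η * ENNReal.ofReal (r ^ n) := by
        rw [e1, e2]; ring
    _ ≤ (ENNReal.ofReal (12 * n / ε) * 2 ^ n * ENNReal.ofReal c₁ + 1) *
          (η * (ENNReal.ofReal (r ^ n) * (ENNReal.ofReal ((6 * n) ^ n) * V))) +
          η * ENNReal.ofReal (r ^ n) := by gcongr
    _ = ENNReal.ofReal (r ^ n) * (η * M) := by rw [hM]; ring
    _ < ENNReal.ofReal (r ^ n) * T := by
        refine (ENNReal.mul_lt_mul_iff_right (ENNReal.ofReal_pos.2 (by positivity)).ne'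
          ENNReal.ofReal_ne_top).2 hηM
    _ = _ := by
        rw [hT, ← mul_assoc, ← ENNReal.ofReal_mul (by positivity), mul_pow, mul_comm (r ^ n)]

theorem ae_avgLimsupRep_eq {n : ℕ} {O : Set (Euc n)} (hO : IsOpen O) {u U : Euc n → ℝ}
    (huU : EqOn u U O) (hU : Integrable U) :
    ∀ᵐ x ∂volume.restrict O, avgLimsupRep u x = u x := by
  rcases subsingleton_or_nontrivial (Euc n) with hs | hs
  · refine Eventually.of_forall fun x => ?_
    refine Tendsto.limsup_eq ?_
    refine tendsto_const_nhds.congr' ?_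
    filter_upwards [self_mem_nhdsWithin] with r hr
    have hfun : u = fun _ => u x := funext fun z => by rw [Subsingleton.elim z x]
    rw [hfun]
    exact (setAverage_const (measure_ball_pos volume x hr).ne' measure_ball_lt_top.ne _).symm
  refine (ae_restrict_iff' hO.measurableSet).2 ?_
  filter_upwards [(Besicovitch.vitaliFamily (volume : Measure (Euc n))).ae_tendsto_average
    hU.locallyIntegrable] with x hx hxO
  rw [huU hxO]
  refine Tendsto.limsup_eq ((hx.comp (Besicovitch.tendsto_filterAt volume x)).congr' ?_)
  obtain ⟨r₀, hr₀, hr₀O⟩ := Metric.isOpen_iff.1 hO x hxO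
  filter_upwards [Ioo_mem_nhdsGT hr₀] with r hr
  have h1 : ball x r =ᵐ[volume] closedBall x r :=
    (ball_subset_closedBall).eventuallyLE.antisymm <| by
      rw [ae_le_set, closedBall_sdiff_ball]
      exact Measure.addHaar_sphere _ _ _
  simp only [Function.comp_apply]
  rw [← setAverage_congr h1]
  exact setAverage_congr_fun measurableSet_ball <| Eventually.of_forall fun z hz =>
    (huU (hr₀O (ball_subset_ball hr.2.le hz))).symm

theorem ae_restrict_of_forall_exists_ball {n : ℕ} {Ω : Set (Euc n)} {P : Euc n → Prop}
    (h : ∀ p ∈ Ω, ∃ R > 0, ∀ᵐ x ∂volume.restrict (ball p R), P x) :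
    ∀ᵐ x ∂volume.restrict Ω, P x := by
  choose! R hR hP using h
  obtain ⟨t, hts, htc, ht⟩ := TopologicalSpace.countable_cover_nhdsWithin (f := fun p => ball p (R p))
    fun p hp => mem_nhdsWithin_of_mem_nhds (ball_mem_nhds p (hR p hp))
  exact ae_mono (Measure.restrict_mono_set _ ht)
    ((ae_restrict_biUnion_iff _ htc _).2 fun p hp => hP p (hts hp))

theorem WeakGradIdentity.indicator {n : ℕ} {Ω O K : Set (Euc n)} {u : Euc n → ℝ}
    {G : Euc n → Euc n} (h : WeakGradIdentity Ω u G) (hOΩ : O ⊆ Ω) (hOK : O ⊆ K) :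
    WeakGradIdentity O (K.indicator u) (K.indicator G) := by
  intro φ hφ hc hs i
  have hz : ∀ x, x ∉ K → φ x = 0 ∧ fderiv ℝ φ x = 0 := fun x hx => by
    have hx1 : x ∉ tsupport φ := fun hxs => hx (hOK (hs hxs))
    exact ⟨image_eq_zero_of_notMem_tsupport hx1, image_eq_zero_of_notMem_tsupport
      fun hxs => hx1 (tsupport_fderiv_subset ℝ hxs)⟩
  have e1 : (fun x => K.indicator u x * fderiv ℝ φ x (EuclideanSpace.single i 1)) =
      fun x => u x * fderiv ℝ φ x (EuclideanSpace.single i 1) := by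
    funext x
    by_cases hx : x ∈ K
    · rw [indicator_of_mem hx]
    · simp [(hz x hx).2]
  have e2 : (fun x => K.indicator G x i * φ x) = fun x => G x i * φ x := by
    funext x
    by_cases hx : x ∈ K
    · rw [indicator_of_mem hx]
    · simp [(hz x hx).1]
  rw [e1, e2]
  exact h φ hφ hc (hs.trans hOΩ) i

theorem WeaklyMonotone.ae_hasGradientAt_avgLimsupRep {e : ℕ} {Φ : ℝ → ℝ} (hΦ : GrowthFn e Φ)
    {Ω O : Set (Euc (e + 2))} {u U : Euc (e + 2) → ℝ} {G : Euc (e + 2) → Euc (e + 2)}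
    (hmon : WeaklyMonotone Ω u) (hO : IsOpen O) (hfin : volume O ≠ ∞) (hOΩ : O ⊆ Ω)
    (huU : EqOn u U O) (hWG : WeakGradIdentity O U G) (hU : Integrable U) (hG : Integrable G)
    (hI : ∫⁻ z in O, ENNReal.ofReal (Φ ‖G z‖) < ∞) :
    ∀ᵐ x ∂volume.restrict O, HasGradientAt (avgLimsupRep u) (G x) x := by
  filter_upwards [hΦ.ae_tendsto_lintegral_div hO hfin hG.aestronglyMeasurable.aemeasurable hI,
    ae_restrict_mem hO.measurableSet] with x hlim hx
  refine hmon.hasGradientAt_avgLimsupRep (hΦ.comp_div (by norm_num : (0 : ℝ) < 4)) hO hOΩ huU hWG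
    hU hG hx (lt_of_le_of_lt (lintegral_mono fun z => ENNReal.ofReal_le_ofReal ?_)
      (hΦ.lintegral_half_norm_sub_lt_top hfin hI (G x))) hlim
  have h0 := norm_nonneg (G z - G x)
  exact hΦ.mono (mem_Ici.2 (by positivity)) (mem_Ici.2 (by positivity)) (by linarith)

theorem weaklyMonotone_ae_differentiable {n : ℕ} (hn : 2 ≤ n)
    (Ω : Set (Euc n)) (hΩ : IsOpen Ω)
    (A : ℝ → ℝ≥0∞) (hA : IsYoung A) (hT : 3 ≤ n → TailCondition n A)
    (u : Euc n → ℝ) (g : Euc n → Euc n) (hu : MemW1Aloc A Ω u g)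
    (hmon : WeaklyMonotone Ω u) :
    (∀ᵐ x ∂volume.restrict Ω, avgLimsupRep u x = u x) ∧
      ∀ᵐ x ∂volume.restrict Ω, DifferentiableAt ℝ (avgLimsupRep u) x := by
  obtain ⟨e, rfl⟩ := Nat.exists_eq_add_of_le' hn
  obtain ⟨Φ, hΦ, hfin⟩ := exists_growthFn hA hT hu
  obtain ⟨G, hGg, hGloc, hWG⟩ := hu.1.exists_locallyIntegrableOn hΩ
  rw [← eventually_and]
  refine ae_restrict_of_forall_exists_ball fun p hp => ?_
  obtain ⟨R, hR, hRΩ⟩ := Metric.nhds_basis_closedBall.mem_iff.1 (hΩ.mem_nhds hp)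
  have hK := isCompact_closedBall p R
  have hbK : ball p R ⊆ closedBall p R := ball_subset_closedBall
  have hcl : closure (ball p R) ⊆ closedBall p R := closure_ball_subset_closedBall
  obtain ⟨s, hs, hI⟩ := hfin (ball p R) isOpen_ball (hK.of_isClosed_subset isClosed_closure hcl)
    (hcl.trans hRΩ)
  have huU : EqOn u ((closedBall p R).indicator u) (ball p R) := fun x hx =>
    (indicator_of_mem (hbK hx) u).symm
  have hU : Integrable ((closedBall p R).indicator u) :=
    (hu.1.1.integrableOn_compact_subset hRΩ hK).integrable_indicator hK.measurableSet
  have hG : Integrable ((closedBall p R).indicator G) :=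
    (hGloc.integrableOn_compact_subset hRΩ hK).integrable_indicator hK.measurableSet
  have hI2 : ∫⁻ z in ball p R, ENNReal.ofReal (Φ (‖(closedBall p R).indicator G z‖ / s)) < ∞ := by
    refine lt_of_le_of_lt (lintegral_mono fun z => ENNReal.ofReal_le_ofReal ?_) hI
    refine hΦ.mono (mem_Ici.2 (by positivity)) (mem_Ici.2 (by positivity)) ?_
    have : ‖(closedBall p R).indicator G z‖ ≤ _ := (norm_indicator_le_norm_self G z).trans (hGg z)
    gcongr
  refine ⟨R, hR, (ae_avgLimsupRep_eq isOpen_ball huU hU).and ?_⟩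
  filter_upwards [hmon.ae_hasGradientAt_avgLimsupRep (hΦ.comp_div hs) isOpen_ball
    measure_ball_lt_top.ne (hbK.trans hRΩ) huU (hWG.indicator (hbK.trans hRΩ) hbK) hU hG hI2]
    with x hx using hx.differentiableAt
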